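/- arXiv:2003.08537 — 5 statements merged into one kernel-verified Lean document; each statement's English description precedes it below -/
import Mathlib

section
/- Let K ⊆ ℝ^{d₁×⋯×dₙ}, let S ⊆ K be a finite subset with |S| > 16, and let Ω ⊆ [d₁]×⋯×[dₙ]. Let σ > 0 and let κ > 0 satisfy κ ≤ σ√(log|S|)/(4·max_{T∈S}‖T_Ω‖_F) and κS ⊆ K (where κS = {κT : T ∈ S}). Let Z ∈ ℝ^{d₁×⋯×dₙ} have i.i.d. entries Z_{i₁⋯iₙ} ∼ N(0,σ²), and let H ∈ ℝ^{d₁×⋯×dₙ} be any tensor. Then for any measurable map A : ℝ^Ω → ℝ^{d₁×⋯×dₙ}, there exists X ∈ K such that, with probability at least 1/2 over the choice of Z, ‖H∘(A(X_Ω + Z_Ω) − X)‖_F ≥ (κ/2)·min_{T ≠ T' ∈ S} ‖H∘(T − T')‖_F. -/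
open MeasureTheory ProbabilityTheory Matrix
open scoped BigOperators ENNReal

namespace WTC

variable {n : ℕ}

/-- The index set `[d₁] × ⋯ × [dₙ]`. -/
abbrev Index (d : Fin n → ℕ) := ∀ j, Fin (d j)

/-- A real tensor of size `d₁ × ⋯ × dₙ`. -/
abbrev Tensor (d : Fin n → ℕ) := Index d → ℝ

variable {d : Fin n → ℕ}

/-- Frobenius norm of a tensor. -/
noncomputable def frobNorm (X : Tensor d) : ℝ :=
  Real.sqrt (∑ i : Index d, X i ^ 2)

/-- Sup (max-abs-entry) norm of a tensor. -/
noncomputable def infNorm (X : Tensor d) : ℝ := ⨆ i : Index d, |X i|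

/-- Hadamard (entrywise) product. -/
def hadamard (X Y : Tensor d) : Tensor d := fun i => X i * Y i

/-- Entrywise real power `X^{(α)}`. -/
noncomputable def epow (X : Tensor d) (α : ℝ) : Tensor d := fun i => X i ^ α

/-- The indicator tensor `1_Ω` of a sampling pattern. -/
def indic (Ω : Finset (Index d)) : Tensor d := fun i => if i ∈ Ω then 1 else 0

/-- The CP rank-one tensor `w₁ ⊗ ⋯ ⊗ wₙ`. -/
def outer (w : ∀ j, Fin (d j) → ℝ) : Tensor d := fun i => ∏ j, w j (i j)

/-- Index type for the columns of the mode-`k` matricization. -/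
abbrev RestIdx (d : Fin n → ℕ) (k : Fin n) := ∀ j : {j : Fin n // j ≠ k}, Fin (d j.1)

/-- Assemble a full index from a mode-`k` index and the remaining indices. -/
def embed (k : Fin n) (ik : Fin (d k)) (rest : RestIdx d k) : Index d :=
  fun j => if h : j = k then cast (congrArg (fun t => Fin (d t)) h).symm ik else rest ⟨j, h⟩

/-- Mode-`k` matricization of a tensor. -/
def matricize (k : Fin n) (X : Tensor d) : Matrix (Fin (d k)) (RestIdx d k) ℝ :=
  fun ik rest => X (embed k ik rest)

/-- Spectral norm (largest singular value) of a matrix. -/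
noncomputable def specNorm {m l : Type*} [Fintype m] [Fintype l] [DecidableEq l]
    (M : Matrix m l ℝ) : ℝ :=
  ‖LinearMap.toContinuousLinearMap (Matrix.toEuclideanLin M)‖

/-- `X` has Tucker rank at most `r`. -/
def TuckerRankLE (X : Tensor d) (r : Fin n → ℕ) : Prop :=
  ∀ k, (matricize k X).rank ≤ r k

/-- `X` has Tucker rank exactly `r`. -/
def TuckerRankEq (X : Tensor d) (r : Fin n → ℕ) : Prop :=
  ∀ k, (matricize k X).rank = r k

/-- `X` has CP rank at most `r`. -/
def CPRankLE (X : Tensor d) (r : ℕ) : Prop :=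
  ∃ v : Fin r → ∀ j, Fin (d j) → ℝ, X = fun i => ∑ s, ∏ j, v s j (i j)

/-- Mode-`k` product of a tensor with a square matrix: `(X ×ₖ A)_(k) = A · X_(k)`. -/
noncomputable def modeProd (k : Fin n) (X : Tensor d)
    (A : Matrix (Fin (d k)) (Fin (d k)) ℝ) : Tensor d :=
  fun i => ∑ s : Fin (d k), A (i k) s * X (Function.update i k s)

/-- Sequential mode products `X ×₁ A₁ ×₂ ⋯ ×ₙ Aₙ`. -/
noncomputable def modeProds (X : Tensor d)
    (A : ∀ k, Matrix (Fin (d k)) (Fin (d k)) ℝ) : Tensor d :=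
  (List.finRange n).foldl (fun Y k => modeProd k Y (A k)) X

/-- `That` is a weighted HOSVD estimate built from observations `Y` (typically `Y = Y_Ω`),
weight `W` and multilinear rank `r`. -/
def IsHOSVDEstimate (W : Tensor d) (r : Fin n → ℕ) (Y : Tensor d) (That : Tensor d) : Prop :=
  ∃ U : ∀ k, Matrix (Fin (d k)) (Fin (r k)) ℝ,
    (∀ k, (U k)ᵀ * U k = 1) ∧
    (∀ k, ∀ B : Matrix (Fin (d k)) (RestIdx d k) ℝ, B.rank ≤ r k →
      specNorm (matricize k (hadamard (epow W (-(1/2))) Y)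
          - U k * (U k)ᵀ * matricize k (hadamard (epow W (-(1/2))) Y))
        ≤ specNorm (matricize k (hadamard (epow W (-(1/2))) Y) - B)) ∧
    That = hadamard (epow W (-(1/2)))
      (modeProds (hadamard (epow W (-(1/2))) Y) (fun k => U k * (U k)ᵀ))

/-- Distribution of a tensor with i.i.d. `N(0, σ²)` entries. -/
noncomputable def gaussianTensor (d : Fin n → ℕ) (σ : ℝ) : Measure (Tensor d) :=
  Measure.pi fun _ : Index d => gaussianReal 0 (σ ^ 2).toNNReal

/-- Bernoulli measure on `Bool` with success probability `p`. -/
noncomputable def bern (p : ℝ) : Measure Bool :=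
  ENNReal.ofReal p • Measure.dirac true + ENNReal.ofReal (1 - p) • Measure.dirac false

/-- Distribution of a random sampling pattern `Ω ∼ W`: each index is included
independently with probability `W i`.  A pattern is encoded as a boolean function. -/
noncomputable def sampleMeasure (W : Tensor d) : Measure (Index d → Bool) :=
  Measure.pi fun i => bern (W i)

/-- Indicator tensor of a boolean sampling pattern. -/
def bindic (ω : Index d → Bool) : Tensor d := fun i => if ω i then 1 else 0

/-- The size `|Ω|` of a boolean sampling pattern. -/
noncomputable def patCard (ω : Index d → Bool) : ℕ :=
  (Finset.univ.filter fun i : Index d => ω i = true).card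


/-- `ℓ¹` norm of a vector. -/
noncomputable def l1 {ι : Type*} [Fintype ι] (v : ι → ℝ) : ℝ := ∑ i, |v i|

/-- `ℓ²` norm of a vector. -/
noncomputable def l2 {ι : Type*} [Fintype ι] (v : ι → ℝ) : ℝ := Real.sqrt (∑ i, v i ^ 2)

/-- `ℓ^∞` norm of a vector. -/
noncomputable def linf {ι : Type*} [Fintype ι] (v : ι → ℝ) : ℝ := ⨆ i, |v i|

/-- Frobenius norm of a matrix. -/
noncomputable def matFrob {m l : Type*} [Fintype m] [Fintype l] (M : Matrix m l ℝ) : ℝ :=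
  Real.sqrt (∑ i, ∑ j, M i j ^ 2)

/-- Kronecker product of a family of square matrices (indexed functionally). -/
def kronFamily {r : Fin n → ℕ} (M : ∀ k, Matrix (Fin (r k)) (Fin (r k)) ℝ) :
    Matrix (∀ k, Fin (r k)) (∀ k, Fin (r k)) ℝ :=
  fun i j => ∏ k, M k (i k) (j k)

/-- The quantity `d_k + ∏_{j ≠ k} d_j`. -/
noncomputable def Dk (d : Fin n → ℕ) (k : Fin n) : ℝ :=
  (d k : ℝ) + ∏ j ∈ Finset.univ.erase k, (d j : ℝ)

/-- The vector `w_k = (h_k ∘ b_k)^{(2)}`. -/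
def wvec {d : Fin n → ℕ} (h b : ∀ j, Fin (d j) → ℝ) (k : Fin n) : Fin (d k) → ℝ :=
  fun ik => (h k ik * b k ik) ^ 2

/-- Law of a uniformly random `±1`-valued tensor (encoded by booleans). -/
noncomputable def signMeasure (ι : Type*) [Fintype ι] [DecidableEq ι] : Measure (ι → Bool) :=
  (PMF.uniformOfFintype (ι → Bool)).toMeasure

/-- Law of a random vector with i.i.d. entries equal to `1` with probability `1/4`,
`-1` with probability `1/4` and `0` with probability `1/2`. -/
noncomputable def xiMeasure (ι : Type*) [Fintype ι] [DecidableEq ι] : Measure (ι → ℝ) :=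
  ((PMF.uniformOfFintype (ι → Fin 4)).map
    (fun b i => (![0, 0, 1, -1] : Fin 4 → ℝ) (b i))).toMeasure

/-- A finite product of measures with densities is the product measure with the product density. -/
lemma pi_withDensity {ι : Type*} [Fintype ι] {E : ι → Type*} [∀ i, MeasurableSpace (E i)]
    (μ : ∀ i, Measure (E i)) [∀ i, IsProbabilityMeasure (μ i)] (f : ∀ i, E i → ℝ≥0∞)
    (hf : ∀ i, Measurable (f i)) [∀ i, SigmaFinite ((μ i).withDensity (f i))] :
    Measure.pi (fun i => (μ i).withDensity (f i))
      = (Measure.pi μ).withDensity (fun x => ∏ i, f i (x i)) := by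
  refine Measure.pi_eq fun s hs => ?_
  have hg : ∀ i, Measurable ((s i).indicator (f i)) := fun i => (hf i).indicator (hs i)
  have hind := iIndepFun_pi (μ := μ) (X := fun i => (s i).indicator (f i))
    fun i => (hg i).aemeasurable
  have hprod : (Set.univ.pi s).indicator (fun x : ∀ i, E i => ∏ i, f i (x i))
      = fun x => ∏ i, (s i).indicator (f i) (x i) := by
    ext x
    by_cases hx : x ∈ Set.univ.pi s
    · rw [Set.indicator_of_mem hx]
      exact Finset.prod_congr rfl fun i _ => by
        rw [Set.indicator_of_mem (hx i (Set.mem_univ i))]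
    · rw [Set.indicator_of_notMem hx]
      obtain ⟨i, hi⟩ : ∃ i, x i ∉ s i := by simpa [Set.mem_pi] using hx
      exact (Finset.prod_eq_zero (Finset.mem_univ i) (Set.indicator_of_notMem hi _)).symm
  rw [withDensity_apply _ (MeasurableSet.univ_pi hs),
    ← lintegral_indicator (MeasurableSet.univ_pi hs), hprod,
    lintegral_prod_eq_prod_lintegral_of_indepFun Finset.univ _ hind
      fun i => (hg i).comp (measurable_pi_apply i)]
  refine Finset.prod_congr rfl fun i _ => ?_
  rw [withDensity_apply _ (hs i), ← lintegral_indicator (hs i),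
    ← (measurePreserving_eval μ i).lintegral_comp (hg i)]

/-- Density of `N(t, v)` with respect to `N(0, v)`. -/
noncomputable def gaussianShiftDensity (v t x : ℝ) : ℝ≥0∞ :=
  ENNReal.ofReal (Real.exp (t * x / v - t ^ 2 / (2 * v)))

lemma measurable_gaussianShiftDensity (v t : ℝ) : Measurable (gaussianShiftDensity v t) := by
  unfold gaussianShiftDensity
  fun_prop

lemma gaussianShiftDensity_sq {v : ℝ} (hv : v ≠ 0) (t x : ℝ) :
    gaussianShiftDensity v t x ^ 2
      = ENNReal.ofReal (Real.exp (t ^ 2 / v)) * gaussianShiftDensity v (2 * t) x := by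
  unfold gaussianShiftDensity
  rw [← ENNReal.ofReal_pow (Real.exp_nonneg _), ← ENNReal.ofReal_mul (Real.exp_nonneg _),
    ← Real.exp_nat_mul, ← Real.exp_add]
  congr 2
  push_cast
  field_simp
  ring

lemma gaussianReal_eq_withDensity_shift {v : NNReal} (hv : v ≠ 0) (t : ℝ) :
    gaussianReal t v = (gaussianReal 0 v).withDensity (gaussianShiftDensity v t) := by
  rw [gaussianReal_of_var_ne_zero _ hv, gaussianReal_of_var_ne_zero _ hv,
    ← withDensity_mul _ (measurable_gaussianPDF 0 v) (measurable_gaussianShiftDensity v t)]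
  congr 1
  ext x
  have hv' : (v : ℝ) ≠ 0 := by exact_mod_cast hv
  simp only [Pi.mul_apply, gaussianPDF, gaussianShiftDensity]
  rw [← ENNReal.ofReal_mul (gaussianPDFReal_nonneg _ _ _)]
  congr 1
  simp only [gaussianPDFReal]
  rw [mul_assoc _ (Real.exp _), ← Real.exp_add]
  congr 2
  field_simp
  ring

section ShiftedProduct

variable {ι : Type*} [Fintype ι] {v : NNReal}

lemma pi_gaussianReal_eq_withDensity (hv : v ≠ 0) (t : ι → ℝ) :
    Measure.pi (fun i => gaussianReal (t i) v)
      = (Measure.pi fun _ : ι => gaussianReal 0 v).withDensity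
          (fun x => ∏ i, gaussianShiftDensity v (t i) (x i)) := by
  have (i : ι) : SigmaFinite ((gaussianReal 0 v).withDensity (gaussianShiftDensity v (t i))) := by
    rw [← gaussianReal_eq_withDensity_shift hv]
    infer_instance
  simp_rw [gaussianReal_eq_withDensity_shift hv (t _)]
  exact pi_withDensity _ _ fun i => measurable_gaussianShiftDensity v (t i)

lemma lintegral_prod_gaussianShiftDensity (hv : v ≠ 0) (t : ι → ℝ) :
    ∫⁻ x, ∏ i, gaussianShiftDensity v (t i) (x i) ∂(Measure.pi fun _ : ι => gaussianReal 0 v)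
      = 1 := by
  rw [← setLIntegral_univ, ← withDensity_apply _ MeasurableSet.univ,
    ← pi_gaussianReal_eq_withDensity hv t, measure_univ]

lemma lintegral_prod_gaussianShiftDensity_sq (hv : v ≠ 0) (t : ι → ℝ) :
    ∫⁻ x, (∏ i, gaussianShiftDensity v (t i) (x i)) ^ 2
        ∂(Measure.pi fun _ : ι => gaussianReal 0 v)
      = ENNReal.ofReal (Real.exp ((∑ i, t i ^ 2) / v)) := by
  have hv' : (v : ℝ) ≠ 0 := by exact_mod_cast hv
  simp_rw [← Finset.prod_pow, gaussianShiftDensity_sq hv', Finset.prod_mul_distrib]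
  rw [lintegral_const_mul' _ _ (ENNReal.prod_ne_top fun i _ => ENNReal.ofReal_ne_top),
    lintegral_prod_gaussianShiftDensity hv (fun i => 2 * t i), mul_one,
    ← ENNReal.ofReal_prod_of_nonneg fun i _ => Real.exp_nonneg _, ← Real.exp_sum,
    Finset.sum_div]

/-- A mean shift of an isotropic Gaussian changes probabilities in a controlled way: this is the
Cauchy-Schwarz inequality applied to the likelihood ratio. -/
lemma pi_gaussianReal_sq_le (hv : v ≠ 0) (t : ι → ℝ) {D : Set (ι → ℝ)} (hD : MeasurableSet D) :
    Measure.pi (fun i => gaussianReal (t i) v) D ^ 2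
      ≤ Measure.pi (fun _ : ι => gaussianReal 0 v) D
        * ENNReal.ofReal (Real.exp ((∑ i, t i ^ 2) / v)) := by
  have hL : Measurable fun x : ι → ℝ => ∏ i, gaussianShiftDensity v (t i) (x i) :=
    Finset.measurable_prod _ fun i _ =>
      (measurable_gaussianShiftDensity v (t i)).comp (measurable_pi_apply i)
  have hCS := ENNReal.lintegral_mul_le_Lp_mul_Lq
    ((Measure.pi fun _ : ι => gaussianReal 0 v).restrict D) Real.HolderConjugate.two_two
    (f := fun _ => 1) aemeasurable_const hL.aemeasurable
  simp only [Pi.mul_apply, one_mul, lintegral_const,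
    Measure.restrict_apply_univ, ENNReal.rpow_two, one_pow] at hCS
  rw [pi_gaussianReal_eq_withDensity hv, withDensity_apply _ hD,
    ← lintegral_prod_gaussianShiftDensity_sq hv t]
  have hsqrt (a : ℝ≥0∞) : (a ^ (1 / 2 : ℝ)) ^ 2 = a := by
    rw [← ENNReal.rpow_two, ← ENNReal.rpow_mul]
    norm_num
  calc _ ≤ _ := pow_le_pow_left' hCS 2
    _ ≤ _ := by
      rw [mul_pow, hsqrt, hsqrt]
      gcongr
      exact Measure.restrict_le_self

lemma map_add_pi_gaussianReal (t : ι → ℝ) :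
    (Measure.pi fun _ : ι => gaussianReal 0 v).map (fun z i => t i + z i)
      = Measure.pi fun i => gaussianReal (t i) v := by
  have (i : ι) : SigmaFinite ((gaussianReal 0 v).map (t i + ·)) := by
    rw [gaussianReal_map_const_add]
    infer_instance
  rw [Measure.pi_map_pi (f := fun i x => t i + x) fun i => by fun_prop]
  simp [gaussianReal_map_const_add]

end ShiftedProduct

section FrobNorm

variable {n : ℕ} {d : Fin n → ℕ}

lemma frobNorm_eq_norm (X : Tensor d) : frobNorm X = ‖WithLp.toLp 2 X‖ := by
  simp [frobNorm, EuclideanSpace.norm_eq]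

lemma frobNorm_sq (X : Tensor d) : frobNorm X ^ 2 = ∑ i, X i ^ 2 :=
  Real.sq_sqrt (Finset.sum_nonneg fun _ _ => sq_nonneg _)

lemma frobNorm_const_mul (c : ℝ) (X : Tensor d) :
    frobNorm (fun i => c * X i) = |c| * frobNorm X := by
  rw [frobNorm_eq_norm, frobNorm_eq_norm, ← Real.norm_eq_abs, ← norm_smul]
  rfl

lemma frobNorm_sub_le (X Y : Tensor d) :
    frobNorm (fun i => X i - Y i) ≤ frobNorm X + frobNorm Y := by
  simp only [frobNorm_eq_norm]
  exact norm_sub_le (WithLp.toLp 2 X) (WithLp.toLp 2 Y)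

lemma measurable_frobNorm : Measurable (frobNorm (d := d)) := by
  unfold frobNorm
  fun_prop

/-- Two codewords cannot both be within half their mutual distance of the same point. -/
lemma le_frobNorm_add_frobNorm_of_separated {H : Tensor d} {c ρ : ℝ} (hc : 0 ≤ c)
    {T T' : Tensor d}
    (hρ : ρ ≤ frobNorm (hadamard H (fun i => T i - T' i))) (a : Tensor d) :
    c * ρ ≤ frobNorm (hadamard H (fun i => a i - c * T' i))
      + frobNorm (hadamard H (fun i => a i - c * T i)) := by
  calc c * ρ ≤ c * frobNorm (hadamard H (fun i => T i - T' i)) := by gcongr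
    _ = frobNorm (fun i => hadamard H (fun i => a i - c * T' i) i
          - hadamard H (fun i => a i - c * T i) i) := by
        rw [← abs_of_nonneg hc, ← frobNorm_const_mul, abs_of_nonneg hc]
        congr 1
        ext i
        simp only [hadamard]
        ring
    _ ≤ _ := frobNorm_sub_le _ _

end FrobNorm

/-- Among finitely many disjoint events, one has probability at most the inverse of their
number. -/
lemma exists_measure_le_inv_card {α β : Type*} [MeasurableSpace α] (μ : Measure α)
    [IsProbabilityMeasure μ] {S : Finset β} (hS : S.Nonempty) {D : β → Set α}
    (hD : ∀ b ∈ S, MeasurableSet (D b)) (hdisj : (S : Set β).PairwiseDisjoint D) :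
    ∃ b ∈ S, μ (D b) ≤ (S.card : ℝ≥0∞)⁻¹ := by
  by_contra! h
  have hsum : ∑ b ∈ S, μ (D b) ≤ 1 := by
    rw [← measure_biUnion_finset hdisj hD]
    exact prob_le_one
  have hlt : ∑ _b ∈ S, (S.card : ℝ≥0∞)⁻¹ < ∑ b ∈ S, μ (D b) :=
    ENNReal.sum_lt_sum_of_nonempty hS h
  rw [Finset.sum_const, nsmul_eq_mul, ENNReal.mul_inv_cancel
    (by exact_mod_cast hS.card_pos.ne') (ENNReal.natCast_ne_top _)] at hlt
  exact absurd hsum hlt.not_ge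

lemma inv_mul_exp_log_div_le {N : ℝ} (hN : 16 ≤ N) :
    N⁻¹ * Real.exp (Real.log N / 16) ≤ 1 / 4 := by
  have hN0 : 0 < N := by linarith
  have h4 : 2 * Real.log 4 ≤ Real.log N := by
    rw [← Real.log_rpow (by norm_num)]
    exact Real.log_le_log (by norm_num) (by norm_num; exact hN)
  have h4' : 0 ≤ Real.log 4 := Real.log_nonneg (by norm_num)
  have hexp : 4 * Real.exp (Real.log N / 16) ≤ N := by
    calc 4 * Real.exp (Real.log N / 16) = Real.exp (Real.log 4 + Real.log N / 16) := by
          rw [Real.exp_add, Real.exp_log (by norm_num)]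
      _ ≤ Real.exp (Real.log N) := Real.exp_le_exp.2 (by linarith)
      _ = N := Real.exp_log hN0
  rw [inv_mul_le_iff₀ hN0]
  linarith

theorem fano_lower_bound
    {n : ℕ} {d : Fin n → ℕ} (K : Set (Tensor d)) (S : Finset (Tensor d))
    (hSK : ↑S ⊆ K) (hScard : 16 < S.card)
    (Ω : Finset (Index d)) (σ : ℝ) (hσ : 0 < σ)
    (κ : ℝ) (hκpos : 0 < κ)
    (hκ : ∀ T ∈ S, 4 * κ * frobNorm (fun i => indic Ω i * T i)
      ≤ σ * Real.sqrt (Real.log (S.card : ℝ)))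
    (hscale : ∀ T ∈ S, (fun i => κ * T i) ∈ K)
    (H : Tensor d) (A : Tensor d → Tensor d) (hA : Measurable A)
    (ρ : ℝ)
    (hρ : IsLeast {x : ℝ | ∃ T ∈ S, ∃ T' ∈ S, T ≠ T' ∧
      x = frobNorm (hadamard H (fun i => T i - T' i))} ρ) :
    ∃ X ∈ K, ENNReal.ofReal (1/2) ≤
      gaussianTensor d σ {z : Tensor d |
        κ / 2 * ρ ≤ frobNorm (hadamard H
          (fun i => A (fun i' => indic Ω i' * (X i' + z i')) i - X i))} := by
  have hσ2 : (σ ^ 2).toNNReal ≠ 0 := by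
    simpa using hσ.ne'
  have hind (i : Index d) : indic Ω i * indic Ω i = indic Ω i := by simp [indic]
  set decode : Tensor d → Set (Tensor d) := fun T => {y |
    frobNorm (hadamard H (fun i => A (fun i' => indic Ω i' * y i') i - κ * T i)) < κ / 2 * ρ}
    with hdecode
  have hmeas (T : Tensor d) : MeasurableSet (decode T) := by
    refine measurableSet_lt (measurable_frobNorm.comp ?_) measurable_const
    refine measurable_pi_lambda _ fun i => Measurable.const_mul (Measurable.sub_const ?_ _) _
    refine (measurable_pi_apply i).comp (hA.comp ?_)
    fun_prop
  have hdisj : (S : Set (Tensor d)).PairwiseDisjoint decode := by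
    intro T hT T' hT' hne
    refine Set.disjoint_left.2 fun y hy hy' => ?_
    have := le_frobNorm_add_frobNorm_of_separated hκpos.le (hρ.2 ⟨T, hT, T', hT', hne, rfl⟩)
      (A fun i' => indic Ω i' * y i')
    simp only [hdecode, Set.mem_ofPred_eq] at hy hy'
    linarith
  have : IsProbabilityMeasure (gaussianTensor d σ) := by
    unfold gaussianTensor
    infer_instance
  obtain ⟨T, hT, hle⟩ := exists_measure_le_inv_card (gaussianTensor d σ)
    (Finset.card_pos.1 (by omega)) (fun T _ => hmeas T) hdisj
  refine ⟨_, hscale T hT, ?_⟩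
  set t : Tensor d := fun i => κ * (indic Ω i * T i) with ht
  have hN : (16 : ℝ) ≤ S.card := by exact_mod_cast hScard.le
  have hlog : 0 ≤ Real.log (S.card : ℝ) := Real.log_nonneg (by linarith)
  have hnorm : (∑ i, t i ^ 2) / σ ^ 2 ≤ Real.log (S.card : ℝ) / 16 := by
    rw [← frobNorm_sq, ht, frobNorm_const_mul, abs_of_pos hκpos, div_le_iff₀ (by positivity)]
    have h0 : 0 ≤ 4 * κ * frobNorm (fun i => indic Ω i * T i) :=
      mul_nonneg (by positivity) (Real.sqrt_nonneg _)
    have hsq := pow_le_pow_left₀ h0 (hκ T hT) 2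
    rw [mul_pow σ, Real.sq_sqrt hlog] at hsq
    linarith
  have hshift : gaussianTensor d σ ((fun z i => t i + z i) ⁻¹' decode T)
      = Measure.pi (fun i => gaussianReal (t i) (σ ^ 2).toNNReal) (decode T) := by
    rw [← map_add_pi_gaussianReal, Measure.map_apply (by fun_prop) (hmeas T)]
    rfl
  have hfail : gaussianTensor d σ ((fun z i => t i + z i) ⁻¹' decode T)
      ≤ ENNReal.ofReal (1 / 2) := by
    rw [hshift, ← ENNReal.pow_le_pow_left_iff two_ne_zero]
    calc _ ≤ _ := pi_gaussianReal_sq_le hσ2 t (hmeas T)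
      _ ≤ (S.card : ℝ≥0∞)⁻¹ * ENNReal.ofReal (Real.exp (Real.log (S.card : ℝ) / 16)) := by
        rw [Real.coe_toNNReal _ (sq_nonneg σ)]
        exact mul_le_mul' hle (ENNReal.ofReal_le_ofReal (Real.exp_le_exp.2 hnorm))
      _ = ENNReal.ofReal ((S.card : ℝ)⁻¹ * Real.exp (Real.log (S.card : ℝ) / 16)) := by
        rw [ENNReal.ofReal_mul (by positivity), ENNReal.ofReal_inv_of_pos (by linarith),
          ENNReal.ofReal_natCast]
      _ ≤ ENNReal.ofReal (1 / 4) := ENNReal.ofReal_le_ofReal (inv_mul_exp_log_div_le hN)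
      _ = ENNReal.ofReal (1 / 2) ^ 2 := by
        rw [← ENNReal.ofReal_pow (by norm_num)]
        norm_num
  have hevent : {z : Tensor d | κ / 2 * ρ ≤ frobNorm (hadamard H
      (fun i => A (fun i' => indic Ω i' * (κ * T i' + z i')) i - κ * T i))}
      = ((fun z i => t i + z i) ⁻¹' decode T)ᶜ := by
    have hobs (z : Tensor d) : (fun i => indic Ω i * (κ * T i + z i))
        = fun i => indic Ω i * (t i + z i) := by
      ext i
      linear_combination (-κ * T i) * hind i
    ext z
    simp [hdecode, hobs z]
  rw [hevent, prob_compl_eq_one_sub ((hmeas T).preimage (by fun_prop))]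
  calc ENNReal.ofReal (1 / 2) = 1 - ENNReal.ofReal (1 / 2) := by
        rw [← ENNReal.ofReal_one, ← ENNReal.ofReal_sub _ (by norm_num)]
        norm_num
    _ ≤ _ := tsub_le_tsub_left hfail 1

end WTC
end

section
/- For all sufficiently large d₁,…,dₙ and r₁,…,rₙ with r_k ≤ d_k, and any entrywise nonnegative vectors w_k ∈ ℝ^{d_k} (k = 1,…,n), letting D_k = diag(w_k), there exist matrices U_k ∈ {±1}^{d_k×r_k} such that: (a) ‖(⊗_{k=1}^n U_kᵀD_kU_k) − (∏_{k=1}^n ‖w_k‖₁)·I‖_F² ≤ (∏_{k=1}^n (2r_k²‖w_k‖₂² + r_k‖w_k‖₁²)) − ∏_{k=1}^n (r_k‖w_k‖₁²); and (b) ‖(⊗_{k=1}^n U_kᵀD_kU_k) − (∏_{k=1}^n ‖w_k‖₁)·I‖₂ ≤ max{ (∏_{k=1}^n (2‖w_k‖₂√(r_k log r_k) + 2‖w_k‖_∞ r_k log r_k + ‖w_k‖₁)) − ∏_{k=1}^n ‖w_k‖₁, ∏_{k=1}^n ‖w_k‖₁ }. -/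
open MeasureTheory ProbabilityTheory Matrix
open scoped BigOperators ENNReal

namespace WTC

variable {n : ℕ}

variable {d : Fin n → ℕ}

/-- If the columns of `K` are orthogonal of squared length `c`, then `K` scales norms by `√c`. -/
lemma sum_sq_mulVec_eq {m l : Type*} [Fintype m] [Fintype l] [DecidableEq l]
    {K : Matrix m l ℝ} {c : ℝ} (hK : Kᵀ * K = c • (1 : Matrix l l ℝ)) (x : l → ℝ) :
    ∑ j, (K *ᵥ x) j ^ 2 = c * ∑ a, x a ^ 2 := by
  have h : (K *ᵥ x) ⬝ᵥ (K *ᵥ x) = c * (x ⬝ᵥ x) := by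
    rw [Matrix.dotProduct_mulVec, Matrix.vecMul_mulVec, ← Matrix.mulVec_transpose]
    simp [hK, Matrix.smul_mulVec]
  simpa [dotProduct, sq] using h

/-- Bessel's inequality for the columns of `K`. -/
lemma sum_sq_transpose_mulVec_le {m l : Type*} [Fintype m] [Fintype l] [DecidableEq l]
    {K : Matrix m l ℝ} {c : ℝ} (hc : 0 < c) (hK : Kᵀ * K = c • (1 : Matrix l l ℝ))
    (v : m → ℝ) :
    ∑ a, (Kᵀ *ᵥ v) a ^ 2 ≤ c * ∑ j, v j ^ 2 := by
  set y := Kᵀ *ᵥ v with hy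
  have h1 : ∑ j, (K *ᵥ y) j ^ 2 = c * ∑ a, y a ^ 2 := sum_sq_mulVec_eq hK y
  have h2 : ∑ j, v j * (K *ᵥ y) j = ∑ a, y a ^ 2 := by
    have : v ⬝ᵥ (K *ᵥ y) = y ⬝ᵥ y := by
      rw [Matrix.dotProduct_mulVec, ← Matrix.mulVec_transpose]
    simpa [dotProduct, sq] using this
  have h3 : 0 ≤ ∑ j, (c * v j - (K *ᵥ y) j) ^ 2 := Finset.sum_nonneg fun _ _ => sq_nonneg _
  have h4 : ∑ j, (c * v j - (K *ᵥ y) j) ^ 2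
      = c ^ 2 * ∑ j, v j ^ 2 - 2 * c * ∑ j, v j * (K *ᵥ y) j + ∑ j, (K *ᵥ y) j ^ 2 := by
    simp only [Finset.mul_sum, ← Finset.sum_sub_distrib, ← Finset.sum_add_distrib]
    exact Finset.sum_congr rfl fun _ _ => by ring
  rw [h4, h1, h2] at h3
  have h5 : 0 ≤ c * (c * ∑ j, v j ^ 2 - ∑ a, y a ^ 2) := by linarith
  linarith [nonneg_of_mul_nonneg_right h5 hc]

lemma specNorm_transpose_diagonal_mul_le {m l : Type*} [Fintype m] [DecidableEq m] [Fintype l]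
    [DecidableEq l] {K : Matrix m l ℝ} {c b : ℝ} (hc : 0 < c) (hb : 0 ≤ b)
    (hK : Kᵀ * K = c • (1 : Matrix l l ℝ)) (D : m → ℝ) (hD : ∀ j, |D j| ≤ b) :
    specNorm (Kᵀ * Matrix.diagonal D * K) ≤ c * b := by
  refine ContinuousLinearMap.opNorm_le_bound _ (by positivity) fun x => ?_
  refine le_of_sq_le_sq ?_ (by positivity)
  rw [mul_pow, EuclideanSpace.real_norm_sq_eq, EuclideanSpace.real_norm_sq_eq]
  have h1 : ∀ a, (LinearMap.toContinuousLinearMap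
      (Matrix.toEuclideanLin (Kᵀ * Matrix.diagonal D * K)) x) a
      = (Kᵀ *ᵥ fun j => D j * (K *ᵥ x.ofLp) j) a := by
    intro a
    have : (fun j => D j * (K *ᵥ x.ofLp) j) = Matrix.diagonal D *ᵥ (K *ᵥ x.ofLp) := by
      ext j; rw [Matrix.mulVec_diagonal]
    rw [this, Matrix.mulVec_mulVec, Matrix.mulVec_mulVec, Matrix.mul_assoc]
    rfl
  simp only [h1]
  have h2 : ∑ j, (D j * (K *ᵥ x.ofLp) j) ^ 2 ≤ b ^ 2 * ∑ j, (K *ᵥ x.ofLp) j ^ 2 := by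
    rw [Finset.mul_sum]
    refine Finset.sum_le_sum fun j _ => ?_
    rw [mul_pow, ← sq_abs (D j)]
    gcongr
    exact hD j
  rw [sum_sq_mulVec_eq hK] at h2
  calc _ ≤ c * ∑ j, (D j * (K *ᵥ x.ofLp) j) ^ 2 := sum_sq_transpose_mulVec_le hc hK _
    _ ≤ c * (b ^ 2 * (c * ∑ a, x a ^ 2)) := by gcongr
    _ = _ := by ring

/-- `r` orthogonal sign vectors in a dimension between `r` and `2 * r`, from Sylvester's
Hadamard matrices. -/
lemma exists_sign_matrix_orthogonal_columns (r : ℕ) (hr : r ≠ 0) :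
    ∃ R : ℕ, 0 < R ∧ R ≤ 2 * r ∧ ∃ H : Matrix (Fin R) (Fin r) ℝ,
      (∀ j a, H j a = 1 ∨ H j a = -1) ∧ Hᵀ * H = (R : ℝ) • (1 : Matrix (Fin r) (Fin r) ℝ) := by
  obtain ⟨m, hm1, hm2⟩ : ∃ m : ℕ, r ≤ 2 ^ m ∧ 2 ^ m ≤ 2 * r := by
    refine ⟨Nat.log 2 r + 1, (Nat.lt_pow_succ_log_self (by norm_num) r).le, ?_⟩
    have := Nat.pow_log_le_self 2 hr
    rw [pow_succ]; omega
  have hcard : Fintype.card (Fin m → Bool) = 2 ^ m := by simp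
  obtain ⟨g⟩ : Nonempty (Fin r ↪ (Fin m → Bool)) :=
    Function.Embedding.nonempty_of_card_le (by simpa using hm1)
  let e : Fin (2 ^ m) ≃ (Fin m → Bool) := (Fintype.equivFinOfCardEq hcard).symm
  let χ : Bool → Bool → ℝ := fun x y => if x && y then -1 else 1
  refine ⟨2 ^ m, by positivity, hm2, Matrix.of fun j a => ∏ i, χ (e j i) (g a i), ?_, ?_⟩
  · intro j a
    rw [Matrix.of_apply]
    refine Finset.prod_induction _ (fun t : ℝ => t = 1 ∨ t = -1) ?_ (Or.inl rfl) ?_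
    · rintro x y (rfl | rfl) (rfl | rfl) <;> simp
    · intro i _
      simp only [χ]
      split_ifs <;> simp
  · ext a b
    rw [Matrix.mul_apply]
    simp only [Matrix.transpose_apply, Matrix.of_apply, Matrix.smul_apply, smul_eq_mul,
      ← Finset.prod_mul_distrib]
    rw [e.sum_comp fun x : Fin m → Bool => ∏ i, χ (x i) (g a i) * χ (x i) (g b i),
      ← Fintype.prod_sum fun i (t : Bool) => χ t (g a i) * χ t (g b i)]
    by_cases hab : a = b
    · subst hab
      have : ∀ i, ∑ t : Bool, χ t (g a i) * χ t (g a i) = 2 := by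
        intro i
        cases g a i <;> norm_num [χ]
      rw [Finset.prod_congr rfl fun i _ => this i]
      simp
    · rw [Matrix.one_apply_ne hab, mul_zero]
      obtain ⟨i, hi⟩ : ∃ i, g a i ≠ g b i := by
        by_contra! h
        exact hab (g.injective (funext h))
      refine Finset.prod_eq_zero (Finset.mem_univ i) ?_
      revert hi
      cases g a i <;> cases g b i <;> simp [χ]

/-- Greedy bin packing: nonnegative weights bounded by `c` can be distributed over `J` so that the
bin loads are nearly equal. -/
lemma exists_balanced_assignment {ι J : Type*} [DecidableEq ι] [Fintype J] [DecidableEq J]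
    [Nonempty J] (w : ι → ℝ) (c : ℝ) (h0 : ∀ i, 0 ≤ w i) (hc : ∀ i, w i ≤ c) (hc0 : 0 ≤ c)
    (s : Finset ι) :
    ∃ f : ι → J,
      (∀ j, ∑ i ∈ s, (if f i = j then w i else 0) ≤ (∑ i ∈ s, w i) / Fintype.card J + c) ∧
      ∑ j, (∑ i ∈ s, (if f i = j then w i else 0) - (∑ i ∈ s, w i) / Fintype.card J) ^ 2
        ≤ ∑ i ∈ s, w i ^ 2 := by
  have hR : (0 : ℝ) < Fintype.card J := by exact_mod_cast Fintype.card_pos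
  have key : ∀ (s : Finset ι) (f : ι → J),
      ∑ j, ∑ i ∈ s, (if f i = j then w i else 0) = ∑ i ∈ s, w i := by
    intro s f
    rw [Finset.sum_comm]
    simp
  induction s using Finset.induction_on with
  | empty => exact ⟨fun _ => Classical.arbitrary J, by simpa using hc0, by simp⟩
  | insert a s ha ih =>
    obtain ⟨f, hf1, hf2⟩ := ih
    have hT := key s f
    set L : J → ℝ := fun j => ∑ i ∈ s, (if f i = j then w i else 0) with hL
    set T := ∑ i ∈ s, w i with hTdef
    set R : ℝ := (Fintype.card J : ℝ) with hRdef
    change ∀ j, L j ≤ T / R + c at hf1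
    change ∑ j, (L j - T / R) ^ 2 ≤ _ at hf2
    change ∑ j, L j = T at hT
    obtain ⟨j₀, hj₀⟩ : ∃ j₀, L j₀ ≤ T / R := by
      by_contra! h
      have : ∑ _j : J, T / R < ∑ j, L j :=
        Finset.sum_lt_sum_of_nonempty Finset.univ_nonempty fun j _ => h j
      rw [hT, Finset.sum_const, Finset.card_univ, nsmul_eq_mul, ← hRdef,
        mul_div_cancel₀ _ hR.ne'] at this
      exact lt_irrefl _ this
    have hload : ∀ j, ∑ i ∈ insert a s, (if Function.update f a j₀ i = j then w i else 0)
        = L j + if j₀ = j then w a else 0 := by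
      intro j
      rw [Finset.sum_insert ha, Function.update_self, add_comm]
      congr 1
      refine Finset.sum_congr rfl fun i hi => ?_
      rw [Function.update_of_ne (ne_of_mem_of_not_mem hi ha)]
    refine ⟨Function.update f a j₀, ?_, ?_⟩
    · intro j
      rw [hload, Finset.sum_insert ha, ← hTdef, add_div]
      have := div_nonneg (h0 a) hR.le
      split_ifs with h
      · subst h
        linarith [hc a]
      · linarith [hf1 j]
    · simp only [hload]
      rw [Finset.sum_insert ha, Finset.sum_insert ha, ← hTdef, add_div]
      have hexp : ∑ j, (L j + (if j₀ = j then w a else 0) - (w a / R + T / R)) ^ 2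
          = ∑ j, (L j - T / R) ^ 2 + (2 * w a * (L j₀ - T / R) + w a ^ 2 - w a ^ 2 / R) := by
        have h1 : ∀ j, (L j + (if j₀ = j then w a else 0) - (w a / R + T / R)) ^ 2
            = (L j - T / R) ^ 2 + (if j₀ = j then
                2 * w a * (L j₀ - T / R) + w a ^ 2 - 2 * w a * (w a / R) else 0)
              - 2 * (w a / R) * (L j - T / R) + (w a / R) ^ 2 := by
          intro j
          split_ifs with h
          · subst h; ring
          · ring
        simp only [h1, Finset.sum_add_distrib, Finset.sum_sub_distrib, ← Finset.mul_sum, hT,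
          Finset.sum_const, Finset.card_univ, nsmul_eq_mul, Finset.sum_ite_eq, Finset.mem_univ,
          if_true, ← hRdef]
        generalize ∑ j, (L j - T / R) ^ 2 = Q
        field_simp
        ring
      rw [hexp]
      have h2 : w a * (L j₀ - T / R) ≤ 0 :=
        mul_nonpos_of_nonneg_of_nonpos (h0 a) (by linarith)
      have h3 : 0 ≤ w a ^ 2 / R := by positivity
      linarith

/-- A sign matrix `U` with `Uᵀ diag(w) U = Hᵀ diag(m) H` for a scaled isometry `H` with sign
entries and a nearly constant vector `m`. -/
lemma exists_sign_matrix_factorization {d r : ℕ} (hr : r ≠ 0) (w : Fin d → ℝ)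
    (h0 : ∀ i, 0 ≤ w i) :
    ∃ (R : ℕ) (H : Matrix (Fin R) (Fin r) ℝ) (m : Fin R → ℝ) (U : Matrix (Fin d) (Fin r) ℝ),
      0 < R ∧ Hᵀ * H = (R : ℝ) • (1 : Matrix (Fin r) (Fin r) ℝ) ∧
      (∀ i j, U i j = 1 ∨ U i j = -1) ∧
      Uᵀ * Matrix.diagonal w * U = Hᵀ * Matrix.diagonal m * H ∧
      (∀ j, 0 ≤ m j) ∧ (∀ j, R * m j ≤ l1 w + 2 * r * linf w) ∧
      ∑ a, ∑ b, (Uᵀ * Matrix.diagonal w * U) a b ^ 2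
        ≤ 2 * (r : ℝ) ^ 2 * l2 w ^ 2 + r * l1 w ^ 2 := by
  obtain ⟨R, hR, hR2, H, hH1, hH⟩ := exists_sign_matrix_orthogonal_columns r hr
  have hR0 : (0 : ℝ) < R := by exact_mod_cast hR
  have hR2' : (R : ℝ) ≤ 2 * r := by exact_mod_cast hR2
  have : Nonempty (Fin R) := ⟨⟨0, hR⟩⟩
  have hl1 : l1 w = ∑ i, w i := Finset.sum_congr rfl fun i _ => abs_of_nonneg (h0 i)
  have hl2 : l2 w ^ 2 = ∑ i, w i ^ 2 := Real.sq_sqrt (Finset.sum_nonneg fun _ _ => sq_nonneg _)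
  have hinf : ∀ i, w i ≤ linf w := fun i =>
    (le_abs_self _).trans (le_ciSup (f := fun i => |w i|) (Set.finite_range _).bddAbove i)
  have hinf0 : 0 ≤ linf w := Real.iSup_nonneg fun _ => abs_nonneg _
  obtain ⟨f, hf1, hf2⟩ :=
    exists_balanced_assignment (J := Fin R) w (linf w) h0 hinf hinf0 Finset.univ
  rw [← hl1, Fintype.card_fin] at hf1 hf2
  rw [← hl2] at hf2
  set m : Fin R → ℝ := fun j => ∑ i, (if f i = j then w i else 0) with hm
  change ∀ j, m j ≤ _ at hf1
  change ∑ j, (m j - _) ^ 2 ≤ _ at hf2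
  have hsq : ∀ j a, H j a ^ 2 = 1 := fun j a => by rcases hH1 j a with h | h <;> simp [h]
  have hA : (Matrix.of fun i a => H (f i) a)ᵀ * Matrix.diagonal w *
      (Matrix.of fun i a => H (f i) a) = Hᵀ * Matrix.diagonal m * H := by
    ext a b
    rw [Matrix.mul_apply, Matrix.mul_apply]
    simp only [Matrix.mul_diagonal, Matrix.transpose_apply, Matrix.of_apply, hm, Finset.mul_sum,
      Finset.sum_mul]
    rw [Finset.sum_comm]
    simp
  refine ⟨R, H, m, Matrix.of fun i a => H (f i) a, hR, hH, fun i j => hH1 _ _, hA, ?_, ?_, ?_⟩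
  · exact fun j => Finset.sum_nonneg fun i _ => by split_ifs <;> simp [h0]
  · intro j
    calc R * m j ≤ R * (l1 w / R + linf w) := by gcongr; exact hf1 j
      _ = l1 w + R * linf w := by field_simp
      _ ≤ _ := by gcongr
  · rw [hA]
    set δ : Fin R → ℝ := fun j => m j - l1 w / R with hδ
    have hB : Hᵀ * Matrix.diagonal m * H
        = Hᵀ * Matrix.diagonal δ * H + l1 w • (1 : Matrix (Fin r) (Fin r) ℝ) := by
      have : Matrix.diagonal m = Matrix.diagonal δ + (l1 w / R) • (1 : Matrix _ _ ℝ) := by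
        ext i j
        by_cases h : i = j
        · subst h; simp [hδ]
        · simp [h]
      rw [this, Matrix.mul_add, Matrix.add_mul, Matrix.mul_smul, Matrix.smul_mul, Matrix.mul_one,
        hH, smul_smul, div_mul_cancel₀ _ hR0.ne']
    have hsumm : ∑ j, m j = l1 w := by
      rw [hm, Finset.sum_comm, hl1]
      simp
    have hdiag : ∀ a, (Hᵀ * Matrix.diagonal δ * H) a a = 0 := by
      intro a
      rw [Matrix.mul_apply]
      have : ∀ j, (Hᵀ * Matrix.diagonal δ) a j * H j a = δ j := fun j => by
        rw [Matrix.mul_diagonal, Matrix.transpose_apply]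
        linear_combination δ j * hsq j a
      rw [Finset.sum_congr rfl fun j _ => this j]
      simp only [hδ, Finset.sum_sub_distrib, hsumm, Finset.sum_const, Finset.card_univ,
        Fintype.card_fin, nsmul_eq_mul]
      field_simp
      ring
    have hrow : ∀ a, ∑ b, (Hᵀ * Matrix.diagonal δ * H) a b ^ 2 ≤ R * l2 w ^ 2 := by
      intro a
      have h1 : ∀ b, (Hᵀ * Matrix.diagonal δ * H) a b = (Hᵀ *ᵥ fun j => δ j * H j a) b := by
        intro b
        rw [Matrix.mul_apply]
        refine Finset.sum_congr rfl fun j _ => ?_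
        rw [Matrix.mul_diagonal, mul_assoc]
        exact mul_left_comm _ _ _ |>.trans (by simp only [Matrix.transpose_apply]; ring)
      simp only [h1]
      refine (sum_sq_transpose_mulVec_le hR0 hH _).trans ?_
      simp only [mul_pow, hsq, mul_one]
      gcongr
    have hrow' : ∀ a, ∑ b, (Hᵀ * Matrix.diagonal m * H) a b ^ 2
        = ∑ b, (Hᵀ * Matrix.diagonal δ * H) a b ^ 2 + l1 w ^ 2 := by
      intro a
      have : ∀ b, (Hᵀ * Matrix.diagonal m * H) a b ^ 2
          = (Hᵀ * Matrix.diagonal δ * H) a b ^ 2 + if a = b then l1 w ^ 2 else 0 := by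
        intro b
        rw [hB]
        by_cases h : a = b
        · subst h; simp [hdiag]
        · simp [h]
      simp [this, Finset.sum_add_distrib]
    calc ∑ a, ∑ b, (Hᵀ * Matrix.diagonal m * H) a b ^ 2
        ≤ ∑ _a : Fin r, (R * l2 w ^ 2 + l1 w ^ 2) := by
          refine Finset.sum_le_sum fun a _ => ?_
          rw [hrow']
          gcongr
          exact hrow a
      _ = r * (R * l2 w ^ 2 + l1 w ^ 2) := by
          rw [Finset.sum_const, Finset.card_univ, Fintype.card_fin, nsmul_eq_mul]
      _ ≤ r * ((2 * r) * l2 w ^ 2 + l1 w ^ 2) := by gcongr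
      _ = _ := by ring

/-- The Kronecker product of a family of possibly rectangular matrices. -/
def rectKronFamily {p r : Fin n → ℕ} (M : ∀ k, Matrix (Fin (p k)) (Fin (r k)) ℝ) :
    Matrix (∀ k, Fin (p k)) (∀ k, Fin (r k)) ℝ :=
  fun i j => ∏ k, M k (i k) (j k)

lemma rectKronFamily_mul {p q r : Fin n → ℕ} (M : ∀ k, Matrix (Fin (p k)) (Fin (q k)) ℝ)
    (N : ∀ k, Matrix (Fin (q k)) (Fin (r k)) ℝ) :
    rectKronFamily M * rectKronFamily N = rectKronFamily fun k => M k * N k := by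
  ext i j
  simp only [Matrix.mul_apply, rectKronFamily, ← Finset.prod_mul_distrib]
  exact (Fintype.prod_sum fun k t => M k (i k) t * N k t (j k)).symm

lemma rectKronFamily_diagonal {r : Fin n → ℕ} (v : ∀ k, Fin (r k) → ℝ) :
    rectKronFamily (fun k => Matrix.diagonal (v k))
      = Matrix.diagonal fun j : ∀ k, Fin (r k) => ∏ k, v k (j k) := by
  ext i j
  by_cases h : i = j
  · subst h; simp [rectKronFamily]
  · obtain ⟨k, hk⟩ := Function.ne_iff.mp h
    rw [Matrix.diagonal_apply_ne _ h]
    exact Finset.prod_eq_zero (Finset.mem_univ k) (Matrix.diagonal_apply_ne _ hk)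

lemma sum_sq_kronFamily {r : Fin n → ℕ} (A : ∀ k, Matrix (Fin (r k)) (Fin (r k)) ℝ) :
    ∑ i, ∑ j, kronFamily A i j ^ 2 = ∏ k, ∑ a, ∑ b, A k a b ^ 2 := by
  simp only [kronFamily, ← Finset.prod_pow]
  rw [Fintype.prod_sum fun k a => ∑ b, A k a b ^ 2]
  refine Finset.sum_congr rfl fun i _ => ?_
  exact (Fintype.prod_sum fun k b => A k (i k) b ^ 2).symm

/-- Subtracting a scalar matrix that matches a constant diagonal. -/
lemma matFrob_sq_sub_smul_one {l : Type*} [Fintype l] [DecidableEq l] (A : Matrix l l ℝ) (s : ℝ)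
    (hA : ∀ i, A i i = s) :
    matFrob (A - s • (1 : Matrix l l ℝ)) ^ 2
      = ∑ i, ∑ j, A i j ^ 2 - Fintype.card l * s ^ 2 := by
  have hsq : matFrob (A - s • (1 : Matrix l l ℝ)) ^ 2
      = ∑ i, ∑ j, (A - s • (1 : Matrix l l ℝ)) i j ^ 2 :=
    Real.sq_sqrt (Finset.sum_nonneg fun _ _ => Finset.sum_nonneg fun _ _ => sq_nonneg _)
  rw [hsq]
  have : ∀ i j, (A - s • (1 : Matrix l l ℝ)) i j ^ 2
      = A i j ^ 2 - if i = j then s ^ 2 else 0 := by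
    intro i j
    by_cases h : i = j
    · subst h; simp [hA]
    · simp [h]
  simp only [this]
  simp [Finset.sum_sub_distrib]

theorem sign_matrices_kronecker_bounds :
    ∃ N₀ : ℕ, ∀ (n : ℕ) (d r : Fin n → ℕ),
      (∀ k, N₀ ≤ d k) → (∀ k, N₀ ≤ r k) → (∀ k, r k ≤ d k) →
      ∀ w : ∀ k, Fin (d k) → ℝ, (∀ k i, 0 ≤ w k i) →
      ∃ U : ∀ k, Matrix (Fin (d k)) (Fin (r k)) ℝ,
        (∀ k i j, U k i j = 1 ∨ U k i j = -1) ∧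
        matFrob (kronFamily (fun k => (U k)ᵀ * Matrix.diagonal (w k) * U k)
            - (∏ k, l1 (w k)) • (1 : Matrix (∀ k, Fin (r k)) (∀ k, Fin (r k)) ℝ)) ^ 2
          ≤ (∏ k, (2 * (r k : ℝ) ^ 2 * l2 (w k) ^ 2 + (r k : ℝ) * l1 (w k) ^ 2))
            - (∏ k, ((r k : ℝ) * l1 (w k) ^ 2)) ∧
        specNorm (kronFamily (fun k => (U k)ᵀ * Matrix.diagonal (w k) * U k)
            - (∏ k, l1 (w k)) • (1 : Matrix (∀ k, Fin (r k)) (∀ k, Fin (r k)) ℝ))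
          ≤ max ((∏ k, (2 * l2 (w k) * Real.sqrt ((r k : ℝ) * Real.log (r k)) +
                2 * linf (w k) * (r k : ℝ) * Real.log (r k) + l1 (w k))) - ∏ k, l1 (w k))
              (∏ k, l1 (w k)) := by
  refine ⟨3, fun n d r _ hr _ w hw => ?_⟩
  have hr0 : ∀ k, r k ≠ 0 := fun k => by have := hr k; omega
  choose R H m U hR hH hU hUH hm0 hm1 hfrob using
    fun k => exists_sign_matrix_factorization (hr0 k) (w k) (hw k)
  have hl1 : ∀ k, 0 ≤ l1 (w k) := fun k => Finset.sum_nonneg fun _ _ => abs_nonneg _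
  refine ⟨U, hU, ?_, ?_⟩
  · have hdiag : ∀ k a, ((U k)ᵀ * Matrix.diagonal (w k) * U k) a a = l1 (w k) := by
      intro k a
      rw [Matrix.mul_apply]
      refine Finset.sum_congr rfl fun i _ => ?_
      rw [Matrix.mul_diagonal, Matrix.transpose_apply, abs_of_nonneg (hw k i)]
      rcases hU k i a with h | h <;> simp [h]
    rw [matFrob_sq_sub_smul_one _ _ fun i : ∀ k, Fin (r k) => Finset.prod_congr rfl fun k _ => hdiag k (i k),
      sum_sq_kronFamily, Fintype.card_pi]
    simp only [Fintype.card_fin, Nat.cast_prod, ← Finset.prod_pow, ← Finset.prod_mul_distrib]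
    refine sub_le_sub_right (Finset.prod_le_prod (fun k _ => ?_) fun k _ => hfrob k) _
    exact Finset.sum_nonneg fun _ _ => Finset.sum_nonneg fun _ _ => sq_nonneg _
  · set S : ℝ := ∏ k, l1 (w k) with hS
    set c : ℝ := ∏ k, (R k : ℝ) with hc
    have hc0 : 0 < c := Finset.prod_pos fun k _ => by exact_mod_cast hR k
    set K := rectKronFamily H with hK
    have hKt : Kᵀ = rectKronFamily fun k => (H k)ᵀ := rfl
    have hKK : Kᵀ * K = c • (1 : Matrix (∀ k, Fin (r k)) (∀ k, Fin (r k)) ℝ) := by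
      rw [hKt, hK, rectKronFamily_mul]
      have : (fun k => (H k)ᵀ * H k) = fun k => Matrix.diagonal fun _ => (R k : ℝ) := by
        funext k
        rw [hH k, Matrix.smul_one_eq_diagonal]
      rw [this, rectKronFamily_diagonal, Matrix.smul_one_eq_diagonal]
    have hkron : kronFamily (fun k => (U k)ᵀ * Matrix.diagonal (w k) * U k) - S • 1
        = Kᵀ * (Matrix.diagonal fun j : ∀ k, Fin (R k) => ∏ k, m k (j k) - S / c) * K := by
      have h1 : kronFamily (fun k => (U k)ᵀ * Matrix.diagonal (w k) * U k)
          = Kᵀ * (Matrix.diagonal fun j : ∀ k, Fin (R k) => ∏ k, m k (j k)) * K := by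
        rw [hKt, hK, ← rectKronFamily_diagonal, rectKronFamily_mul, rectKronFamily_mul]
        simp only [hUH]
        rfl
      have h2 : (Matrix.diagonal fun j : ∀ k, Fin (R k) => ∏ k, m k (j k) - S / c)
          = (Matrix.diagonal fun j : ∀ k, Fin (R k) => ∏ k, m k (j k))
            - (S / c) • (1 : Matrix _ _ ℝ) := by
        rw [Matrix.smul_one_eq_diagonal, Matrix.diagonal_sub]
      rw [h1, h2, Matrix.mul_sub, Matrix.sub_mul, Matrix.mul_smul, Matrix.smul_mul,
        Matrix.mul_one, hKK, smul_smul, div_mul_cancel₀ _ hc0.ne']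
    rw [hkron]
    set P : ℝ := ∏ k, (2 * l2 (w k) * Real.sqrt ((r k : ℝ) * Real.log (r k)) +
      2 * linf (w k) * (r k : ℝ) * Real.log (r k) + l1 (w k)) with hP
    have hS0 : 0 ≤ S := Finset.prod_nonneg fun k _ => hl1 k
    have hle : ∀ k (j : Fin (R k)), R k * m k j ≤
        2 * l2 (w k) * Real.sqrt ((r k : ℝ) * Real.log (r k)) +
          2 * linf (w k) * (r k : ℝ) * Real.log (r k) + l1 (w k) := by
      intro k j
      have h1 : (1 : ℝ) ≤ Real.log (r k) := by
        have h3 : (3 : ℝ) ≤ r k := by exact_mod_cast hr k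
        rw [Real.le_log_iff_exp_le (by linarith)]
        linarith [Real.exp_one_lt_d9]
      have h2 : 0 ≤ linf (w k) := Real.iSup_nonneg fun _ => abs_nonneg _
      have h3 : 0 ≤ 2 * l2 (w k) * Real.sqrt ((r k : ℝ) * Real.log (r k)) :=
        mul_nonneg (mul_nonneg zero_le_two (Real.sqrt_nonneg _)) (Real.sqrt_nonneg _)
      have h4 : 2 * linf (w k) * (r k : ℝ) * 1 ≤ 2 * linf (w k) * (r k : ℝ) * Real.log (r k) := by
        gcongr
      linarith [hm1 k j]
    have hbound : ∀ j : ∀ k, Fin (R k), |∏ k, m k (j k) - S / c| ≤ max (P - S) S / c := by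
      intro j
      rw [le_div_iff₀ hc0, ← abs_of_pos hc0, ← abs_mul, abs_of_pos hc0, sub_mul,
        div_mul_cancel₀ _ hc0.ne', hc, ← Finset.prod_mul_distrib]
      have h1 : 0 ≤ ∏ k, m k (j k) * (R k : ℝ) :=
        Finset.prod_nonneg fun k _ => mul_nonneg (hm0 k _) (Nat.cast_nonneg _)
      have h2 : ∏ k, m k (j k) * (R k : ℝ) ≤ P :=
        Finset.prod_le_prod (fun k _ => mul_nonneg (hm0 k _) (Nat.cast_nonneg _))
          fun k _ => by rw [mul_comm]; exact hle k (j k)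
      rw [abs_le]
      constructor
      · linarith [le_max_right (P - S) S]
      · linarith [le_max_left (P - S) S]
    have hmax : 0 ≤ max (P - S) S := le_max_of_le_right hS0
    refine (specNorm_transpose_diagonal_mul_le hc0 (div_nonneg hmax hc0.le) hKK _ hbound).trans ?_
    rw [mul_div_cancel₀ _ hc0.ne']

end WTC
end

section
/- There exist absolute constants c', c'' > 0 such that the following holds. Let w_k ∈ ℝ^{d_k} be entrywise nonnegative vectors, D_k = diag(w_k), and let U_k ∈ {±1}^{d_k×r_k} satisfy: (a) ‖(⊗_{k=1}^n U_kᵀD_kU_k) − (∏‖w_k‖₁)I‖_F² ≤ (∏(2r_k²‖w_k‖₂² + r_k‖w_k‖₁²)) − ∏(r_k‖w_k‖₁²) and (b) ‖(⊗_{k=1}^n U_kᵀD_kU_k) − (∏‖w_k‖₁)I‖₂ ≤ max{ (∏(2‖w_k‖₂√(r_k log r_k) + 2‖w_k‖_∞ r_k log r_k + ‖w_k‖₁)) − ∏‖w_k‖₁, ∏‖w_k‖₁ }. Let ξ ∈ ℝ^{∏r_k} be a random vector with i.i.d. entries taking value 1 with probability 1/4, −1 with probability 1/4, and 0 with probability 1/2.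 Then with probability at least 1 − 2exp(−c''·∏r_k) − 2exp(−c'·min{ (∏(r_k‖w_k‖₁²))/((∏(2r_k‖w_k‖₂² + ‖w_k‖₁²)) − ∏‖w_k‖₁²), ∏r_k, (∏(r_k‖w_k‖₁))/((∏(2‖w_k‖₂√(r_k log r_k) + 2‖w_k‖_∞ r_k log r_k + ‖w_k‖₁)) − ∏‖w_k‖₁) }), one has 4ξᵀ(⊗_{k=1}^n U_kᵀD_kU_k)ξ ≥ ∏_{k=1}^n (r_k‖w_k‖₁). -/
open MeasureTheory ProbabilityTheory Matrix
open scoped BigOperators ENNReal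

namespace WTC

variable {n : ℕ}

variable {d : Fin n → ℕ}

/-- The entry of the random vector encoded by an element of `Fin 4`. -/
def entry : Fin 4 → ℝ := ![0, 0, 1, -1]

lemma sum_exp_entry_le {a : ℝ} (ha : 0 ≤ a) (ha1 : 0 < 1 - 2 * a) (y : ℝ) :
    ∑ b : Fin 4, Real.exp (a * entry b ^ 2 + 2 * entry b * y)
      ≤ 4 * ((Real.sqrt (1 - 2 * a))⁻¹ * Real.exp (2 * y ^ 2 / (1 - 2 * a))) := by
  have hcosh : Real.exp (2 * y) + Real.exp (-(2 * y)) ≤ 2 * Real.exp (2 * y ^ 2) := by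
    have := Real.cosh_le_exp_half_sq (2 * y)
    rw [Real.cosh_eq] at this
    have h2 : (2 * y) ^ 2 / 2 = 2 * y ^ 2 := by ring
    rw [h2] at this
    linarith
  have hea : 1 ≤ Real.exp a := Real.one_le_exp ha
  have hey : 1 ≤ Real.exp (2 * y ^ 2) := Real.one_le_exp (by positivity)
  have hsum : ∑ b : Fin 4, Real.exp (a * entry b ^ 2 + 2 * entry b * y)
      = 2 + Real.exp a * (Real.exp (2 * y) + Real.exp (-(2 * y))) := by
    simp only [Fin.sum_univ_four, entry]
    simp [← Real.exp_add, mul_add]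
    ring
  have h1 : Real.exp a ≤ (Real.sqrt (1 - 2 * a))⁻¹ := by
    rw [le_inv_comm₀ (Real.exp_pos _) (Real.sqrt_pos.2 ha1), ← Real.exp_neg]
    rw [Real.sqrt_le_left (Real.exp_pos _).le, ← Real.exp_nat_mul]
    have := Real.add_one_le_exp (((2 : ℕ) : ℝ) * -a)
    push_cast at *
    linarith
  have h2 : Real.exp (2 * y ^ 2) ≤ Real.exp (2 * y ^ 2 / (1 - 2 * a)) := by
    refine Real.exp_le_exp.2 ?_
    rw [le_div_iff₀ ha1]
    nlinarith [mul_nonneg (mul_nonneg (sq_nonneg y) ha) zero_le_two]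
  calc _ = 2 + Real.exp a * (Real.exp (2 * y) + Real.exp (-(2 * y))) := hsum
    _ ≤ 2 * (Real.exp a * Real.exp (2 * y ^ 2)) + Real.exp a * (2 * Real.exp (2 * y ^ 2)) := by
        gcongr
        nlinarith
    _ = 4 * (Real.exp a * Real.exp (2 * y ^ 2)) := by ring
    _ ≤ _ := by gcongr

/-- Completing the square in the last coordinate of a quadratic form. -/
lemma sum_unit_quadForm {α : Type*} [Fintype α] (M : Matrix (α ⊕ Unit) (α ⊕ Unit) ℝ)
    (hM : M.IsSymm) (x : α → ℝ) (z : ℝ) :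
    (Sum.elim x fun _ => z) ⬝ᵥ M *ᵥ (Sum.elim x fun _ => z)
      = x ⬝ᵥ M.toBlocks₁₁ *ᵥ x + (M (.inr ()) (.inr ()) * z ^ 2
        + 2 * z * ∑ i, M (.inl i) (.inr ()) * x i) := by
  have h : ∀ i, M (.inr ()) (.inl i) = M (.inl i) (.inr ()) := fun i => hM.apply _ _
  simp only [dotProduct, mulVec, Fintype.sum_sum_type, toBlocks₁₁, Matrix.of_apply]
  simp [h, mul_add, Finset.sum_add_distrib, Finset.mul_sum]
  have : ∑ i, x i * (M (.inl i) (.inr ()) * z) = ∑ i, z * (M (.inl i) (.inr ()) * x i) :=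
    Finset.sum_congr rfl fun i _ => by ring
  have h2 : ∑ i, 2 * z * (M (.inl i) (.inr ()) * x i)
      = 2 * ∑ i, z * (M (.inl i) (.inr ()) * x i) := by
    rw [Finset.mul_sum]
    exact Finset.sum_congr rfl fun i _ => by ring
  rw [this, h2]
  ring

lemma outer_quadForm {α : Type*} [Fintype α] (A : Matrix α α ℝ) (b : α → ℝ) (c : ℝ)
    (x : α → ℝ) :
    x ⬝ᵥ (A + c • vecMulVec b b) *ᵥ x = x ⬝ᵥ A *ᵥ x + c * (∑ i, b i * x i) ^ 2 := by
  have : x ⬝ᵥ b = ∑ i, b i * x i := by simp [dotProduct, mul_comm]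
  rw [add_mulVec, dotProduct_add, smul_mulVec, vecMulVec_mulVec]
  simp [dotProduct_smul, this]
  left
  simp only [dotProduct]
  ring

lemma det_schur_unit {α : Type*} [Fintype α] [DecidableEq α]
    (M : Matrix (α ⊕ Unit) (α ⊕ Unit) ℝ) (hM : M.IsSymm) (hs : M (.inr ()) (.inr ()) ≠ 0) :
    M.det = M (.inr ()) (.inr ()) * (M.toBlocks₁₁ - (M (.inr ()) (.inr ()))⁻¹ •
      vecMulVec (fun i => M (.inl i) (.inr ())) (fun i => M (.inl i) (.inr ()))).det := by
  let inv : Invertible M.toBlocks₂₂ := ⟨.of fun _ _ => (M (.inr ()) (.inr ()))⁻¹, by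
    ext; simp [toBlocks₂₂, mul_apply, hs], by ext; simp [toBlocks₂₂, mul_apply, hs]⟩
  conv_lhs => rw [← fromBlocks_toBlocks M, det_fromBlocks₂₂]
  congr 1
  · simp [toBlocks₂₂]
  · congr 2
    ext i j
    have : M (.inr ()) (.inl j) = M (.inl j) (.inr ()) := hM.apply _ _
    change ∑ x : Unit, (∑ y : Unit, M (.inl i) (.inr ()) * (M (.inr ()) (.inr ()))⁻¹) *
      M (.inr ()) (.inl j) = _
    simp [vecMulVec_apply, this]
    ring

/-- The moment generating function of every quadratic form with nonnegative diagonal in random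
entries indexed by `ι` is at most the Gaussian one. -/
def GaussianDominated (ι : Type*) [Fintype ι] [DecidableEq ι] : Prop :=
  ∀ (Q : Matrix ι ι ℝ), (∀ i, 0 ≤ Q i i) → (1 - (2 : ℝ) • Q).PosDef →
    ∑ b : ι → Fin 4, Real.exp ((fun i => entry (b i)) ⬝ᵥ Q *ᵥ fun i => entry (b i))
      ≤ 4 ^ Fintype.card ι * (Real.sqrt (1 - (2 : ℝ) • Q).det)⁻¹

lemma GaussianDominated.of_equiv {α β : Type*} [Fintype α] [DecidableEq α] [Fintype β]
    [DecidableEq β] (e : α ≃ β)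
    (h : GaussianDominated α) : GaussianDominated β := by
  intro Q hQ hpos
  have hsub : (1 - (2 : ℝ) • Q.submatrix e e) = (1 - (2 : ℝ) • Q).submatrix e e := by
    ext i j; simp [one_apply]
  have := h (Q.submatrix e e) (fun i => hQ _) (by
    rw [hsub]; exact hpos.submatrix e.injective)
  rw [hsub, det_submatrix_equiv_self, Fintype.card_congr e] at this
  refine le_of_eq_of_le ?_ this
  refine Fintype.sum_equiv (Equiv.arrowCongr e.symm (Equiv.refl _)) _ _ fun b => ?_
  congr 1
  rw [submatrix_mulVec_equiv]
  simp only [dotProduct]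
  refine Fintype.sum_equiv e.symm _ _ fun i => ?_
  simp [Function.comp_def]

lemma GaussianDominated.sum_unit {α : Type*} [Fintype α] [DecidableEq α] (h : GaussianDominated α) :
    GaussianDominated (α ⊕ Unit) := by
  intro Q hQ hpos
  set a := Q (.inr ()) (.inr ()) with ha
  set b : α → ℝ := fun i => Q (.inl i) (.inr ()) with hb
  have hsymm : (1 - (2 : ℝ) • Q).IsSymm := by simpa using hpos.isHermitian
  have hQs : Q.IsSymm := by
    ext i j
    have := hsymm.apply i j
    simp only [Matrix.sub_apply, Matrix.smul_apply, smul_eq_mul, one_apply, eq_comm (a := j)] at this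
    rw [transpose_apply]
    linarith
  have hcorner : (1 - (2 : ℝ) • Q) (.inr ()) (.inr ()) = 1 - 2 * a := by simp [ha]
  have hcol : (fun i => (1 - (2 : ℝ) • Q) (.inl i) (.inr ())) = fun i => -2 * b i := by
    ext i; simp [hb]
  have ha1 : 0 < 1 - 2 * a := by
    have := hpos.diag_pos (i := .inr ())
    rwa [hcorner] at this
  have hQ' : 1 - (2 : ℝ) • (Q.toBlocks₁₁ + (2 / (1 - 2 * a)) • vecMulVec b b)
      = (1 - (2 : ℝ) • Q).toBlocks₁₁ - (1 - 2 * a)⁻¹ •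
        vecMulVec (fun i => -2 * b i) (fun i => -2 * b i) := by
    ext i j
    simp [toBlocks₁₁, vecMulVec_apply, one_apply]
    ring
  have hdet := det_schur_unit _ hsymm (by rw [hcorner]; exact ha1.ne')
  rw [hcorner, hcol, ← hQ'] at hdet
  have hpos' : (1 - (2 : ℝ) • (Q.toBlocks₁₁ + (2 / (1 - 2 * a)) • vecMulVec b b)).PosDef := by
    refine .of_dotProduct_mulVec_pos ?_ fun x hx => ?_
    · ext i j
      have := hQs.apply (.inl i) (.inl j)
      simp [toBlocks₁₁, vecMulVec_apply, one_apply, eq_comm (a := j), this, mul_comm (b j)]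
    · set S := ∑ i, (-2 * b i) * x i with hS
      have h1 := hpos.dotProduct_mulVec_pos (x := Sum.elim x fun _ => -(1 - 2 * a)⁻¹ * S)
        fun h0 => hx <| by ext i; exact congrFun h0 (.inl i)
      rw [star_trivial, sum_unit_quadForm _ hsymm, hcorner,
        show ∑ i, (1 - (2 : ℝ) • Q) (.inl i) (.inr ()) * x i = S from
          Finset.sum_congr rfl fun i _ => by rw [congrFun hcol i]] at h1
      rw [hQ', star_trivial, sub_eq_add_neg, ← neg_smul, outer_quadForm, ← hS]
      refine h1.trans_eq ?_
      field_simp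
      ring
  have key := h _ (fun i => ?_) hpos'
  · rw [← (Equiv.sumArrowEquivProdArrow α Unit (Fin 4)).symm.sum_comp, Fintype.sum_prod_type]
    have hinner : ∀ c : α → Fin 4, ∑ e : Unit → Fin 4,
        Real.exp ((fun i => entry ((Equiv.sumArrowEquivProdArrow α Unit (Fin 4)).symm (c, e) i)) ⬝ᵥ
          Q *ᵥ fun i => entry ((Equiv.sumArrowEquivProdArrow α Unit (Fin 4)).symm (c, e) i))
        ≤ 4 * (Real.sqrt (1 - 2 * a))⁻¹ * Real.exp ((fun i => entry (c i)) ⬝ᵥ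
          (Q.toBlocks₁₁ + (2 / (1 - 2 * a)) • vecMulVec b b) *ᵥ fun i => entry (c i)) := by
      intro c
      have hvec : ∀ e : Unit → Fin 4,
          (fun i => entry ((Equiv.sumArrowEquivProdArrow α Unit (Fin 4)).symm (c, e) i))
            = Sum.elim (fun i => entry (c i)) fun _ => entry (e ()) := by
        intro e; ext (i | i) <;> rfl
      simp only [hvec, sum_unit_quadForm _ hQs, outer_quadForm, Real.exp_add, ← Finset.mul_sum]
      rw [Fintype.sum_equiv (Equiv.funUnique Unit (Fin 4)) (fun e => Real.exp (a * entry (e ()) ^ 2)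
        * Real.exp (2 * entry (e ()) * ∑ i, b i * entry (c i))) (fun e => Real.exp (a * entry e ^ 2)
        * Real.exp (2 * entry e * ∑ i, b i * entry (c i))) fun e => rfl]
      have := sum_exp_entry_le (hQ (.inr ())) ha1 (∑ i, b i * entry (c i))
      simp only [Real.exp_add] at this
      calc _ ≤ _ := mul_le_mul_of_nonneg_left this (Real.exp_pos _).le
        _ = _ := by
          rw [mul_comm 2 (_ ^ 2 : ℝ), mul_div_assoc, mul_comm (2 / _)]
          ring
    refine (Finset.sum_le_sum fun c _ => hinner c).trans ?_
    rw [← Finset.mul_sum, hdet, Real.sqrt_mul ha1.le, mul_inv]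
    refine (mul_le_mul_of_nonneg_left key (by positivity)).trans_eq ?_
    rw [Fintype.card_sum, Fintype.card_unit, pow_succ]
    ring
  · have := hQ (.inl i)
    simp only [Matrix.add_apply, toBlocks₁₁, of_apply, Matrix.smul_apply, vecMulVec_apply, smul_eq_mul]
    have := mul_self_nonneg (b i)
    positivity

theorem gaussianDominated (ι : Type*) [Fintype ι] : ∀ [DecidableEq ι], GaussianDominated ι := by
  refine Fintype.induction_empty_option
    (P := fun ι _ => ∀ [DecidableEq ι], GaussianDominated ι) ?_ ?_ ?_ ι
  · intro α β _ e h _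
    classical
    let := Fintype.ofEquiv β e.symm
    exact h.of_equiv e
  · intro _ Q _ _
    simp
  · intro α _ h _
    classical
    exact h.sum_unit.of_equiv (Equiv.optionEquivSumPUnit α).symm

lemma trace_mul_self_eq_sum_eigenvalues_sq {ι : Type*} [Fintype ι] [DecidableEq ι] {B : Matrix ι ι ℝ}
    (hB : B.IsHermitian) :
    (B * B).trace = ∑ i, hB.eigenvalues i ^ 2 := by
  have h : B * B = Unitary.conjStarAlgAut ℝ _ hB.eigenvectorUnitary
      (diagonal (hB.eigenvalues) * diagonal (hB.eigenvalues)) := by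
    rw [map_mul]
    congr 1 <;> exact hB.spectral_theorem
  rw [h, Unitary.conjStarAlgAut_apply, trace_mul_comm, ← mul_assoc]
  simp [trace, diagonal_mul_diagonal, sq]

/-- Second-order lower bound for the determinant near the identity. -/
lemma exp_le_det {ι : Type*} [Fintype ι] [DecidableEq ι] {E : Matrix ι ι ℝ}
    (hE : E.IsHermitian) (htr : E.trace = 0)
    (hlow : (1 + E - (1 / 2 : ℝ) • (1 : Matrix ι ι ℝ)).PosSemidef) :
    Real.exp (-(2 * ∑ i, ∑ j, E i j ^ 2)) ≤ (1 + E).det := by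
  have hB : (1 + E).IsHermitian := isHermitian_one.add hE
  have hμ : ∀ i, 1 / 2 ≤ hB.eigenvalues i := by
    intro i
    have h1 := hlow.dotProduct_mulVec_nonneg (⇑(hB.eigenvectorBasis i))
    rw [sub_mulVec, hB.mulVec_eigenvectorBasis, smul_mulVec, one_mulVec, ← sub_smul,
      dotProduct_smul, smul_eq_mul] at h1
    have h2 : star ⇑(hB.eigenvectorBasis i) ⬝ᵥ ⇑(hB.eigenvectorBasis i) = (1 : ℝ) := by
      have := EuclideanSpace.inner_eq_star_dotProduct (hB.eigenvectorBasis i) (hB.eigenvectorBasis i)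
      rw [real_inner_self_eq_norm_sq, hB.eigenvectorBasis.norm_eq_one] at this
      rw [dotProduct_comm]
      simpa using this.symm
    rw [h2] at h1
    linarith
  have htr1 : ∑ i, (hB.eigenvalues i - 1) = 0 := by
    have := hB.trace_eq_sum_eigenvalues
    rw [trace_add, htr, trace_one] at this
    simp at this
    simp [← this]
  have htr2 : ∑ i, (hB.eigenvalues i - 1) ^ 2 = ∑ i, ∑ j, E i j ^ 2 := by
    have h1 : ∑ i, (hB.eigenvalues i - 1) ^ 2
        = (∑ i, hB.eigenvalues i ^ 2) - 2 * ∑ i, (hB.eigenvalues i - 1) - Fintype.card ι := by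
      rw [Finset.mul_sum, ← Finset.sum_sub_distrib]
      have : (Fintype.card ι : ℝ) = ∑ _i : ι, (1 : ℝ) := by simp
      rw [this, ← Finset.sum_sub_distrib]
      exact Finset.sum_congr rfl fun i _ => by ring
    have h2 : (E * E).trace = ∑ i, ∑ j, E i j ^ 2 := by
      simp only [trace, diag_apply, mul_apply, sq]
      refine Finset.sum_congr rfl fun i _ => Finset.sum_congr rfl fun j _ => ?_
      rw [← hE.apply i j]; simp
    rw [h1, htr1, ← trace_mul_self_eq_sum_eigenvalues_sq, ← h2, mul_add, add_mul, add_mul]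
    simp [htr]
  rw [hB.det_eq_prod_eigenvalues, ← htr2]
  have : -(2 * ∑ i, (hB.eigenvalues i - 1) ^ 2)
      = ∑ i, ((hB.eigenvalues i - 1) - 2 * (hB.eigenvalues i - 1) ^ 2) := by
    rw [Finset.sum_sub_distrib, htr1, Finset.mul_sum, zero_sub]
  rw [this, Real.exp_sum]
  refine Finset.prod_le_prod (fun _ _ => (Real.exp_pos _).le) fun i _ => ?_
  have hp : 0 < hB.eigenvalues i := by linarith [hμ i]
  have hm := hμ i
  simp only [RCLike.ofReal_real_eq_id, id]
  rw [← Real.le_log_iff_exp_le hp]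
  refine le_trans ?_ (Real.one_sub_inv_le_log_of_pos hp)
  rw [← sub_nonneg]
  have : 1 - (hB.eigenvalues i)⁻¹ - (hB.eigenvalues i - 1 - 2 * (hB.eigenvalues i - 1) ^ 2)
      = (hB.eigenvalues i - 1) ^ 2 * (2 * hB.eigenvalues i - 1) / hB.eigenvalues i := by
    field_simp
    ring
  rw [this]
  have : 0 ≤ 2 * hB.eigenvalues i - 1 := by linarith
  positivity

/-- Lower-tail exponential moment of an off-diagonal quadratic form bounded below by `-P`. -/
lemma sum_exp_neg_quadForm_le {ι : Type*} [Fintype ι] [DecidableEq ι] {E : Matrix ι ι ℝ} {P t : ℝ}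
    (hE : E.IsHermitian) (hdiag : ∀ i, E i i = 0)
    (hlow : (E + P • (1 : Matrix ι ι ℝ)).PosSemidef) (ht : 0 ≤ t) (htP : t * P ≤ 1 / 4) :
    ∑ b : ι → Fin 4, Real.exp (-t * ((fun i => entry (b i)) ⬝ᵥ E *ᵥ fun i => entry (b i)))
      ≤ 4 ^ Fintype.card ι * Real.exp (4 * t ^ 2 * ∑ i, ∑ j, E i j ^ 2) := by
  have heq : 1 - (2 : ℝ) • (-t • E) = 1 + (2 * t) • E := by
    ext i j; simp; ring
  have hlow' : (1 + (2 * t) • E - (1 / 2 : ℝ) • (1 : Matrix ι ι ℝ)).PosSemidef := by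
    have : 1 + (2 * t) • E - (1 / 2 : ℝ) • (1 : Matrix ι ι ℝ)
        = (2 * t) • (E + P • (1 : Matrix ι ι ℝ)) + (1 / 2 - 2 * (t * P)) • (1 : Matrix ι ι ℝ) := by
      module
    rw [this]
    exact (hlow.smul (by positivity)).add (PosSemidef.one.smul (by linarith))
  have hpos : (1 - (2 : ℝ) • (-t • E)).PosDef := by
    have : 1 + (2 * t) • E = (1 / 2 : ℝ) • (1 : Matrix ι ι ℝ)
        + (1 + (2 * t) • E - (1 / 2 : ℝ) • (1 : Matrix ι ι ℝ)) := by module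
    rw [heq, this]
    exact (PosDef.one.smul (by norm_num)).add_posSemidef hlow'
  have h := gaussianDominated ι (-t • E) (by simp [hdiag]) hpos
  have hdet := exp_le_det (E := (2 * t) • E) (by
    rw [IsHermitian, conjTranspose_smul, hE.eq, star_trivial]) (by simp [trace, hdiag]) hlow'
  rw [heq] at h
  have hF : ∑ i, ∑ j, ((2 * t) • E) i j ^ 2 = 4 * t ^ 2 * ∑ i, ∑ j, E i j ^ 2 := by
    simp only [Finset.mul_sum, Matrix.smul_apply, smul_eq_mul]
    exact Finset.sum_congr rfl fun i _ => Finset.sum_congr rfl fun j _ => by ring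
  rw [hF] at hdet
  refine le_of_eq_of_le ?_ (h.trans ?_)
  · refine Finset.sum_congr rfl fun b _ => ?_
    rw [smul_mulVec, dotProduct_smul, smul_eq_mul]
  · gcongr
    rw [← inv_inv (Real.exp _), ← Real.exp_neg]
    refine inv_anti₀ (Real.exp_pos _) (Real.le_sqrt_of_sq_le ?_)
    rw [← Real.exp_nat_mul]
    refine le_trans (le_of_eq ?_) hdet
    congr 1
    push_cast
    ring
lemma card_lt_le_sum_exp {β : Type*} [Fintype β] (f : β → ℝ) (c : ℝ) {t : ℝ} (ht : 0 ≤ t) :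
    ((Finset.univ.filter fun b => f b < c).card : ℝ) ≤ ∑ b, Real.exp (t * c + -t * f b) := by
  rw [Finset.card_eq_sum_ones, Nat.cast_sum]
  refine (Finset.sum_le_sum fun b hb => ?_).trans
    (Finset.sum_le_univ_sum_of_nonneg fun b => (Real.exp_pos _).le)
  rw [Nat.cast_one, Real.one_le_exp_iff]
  nlinarith [(Finset.mem_filter.1 hb).2]

/-- Lower tail for the number of nonzero entries. -/
lemma card_sum_sq_lt_le (ι : Type*) [Fintype ι] [DecidableEq ι] :
    ((Finset.univ.filter fun b : ι → Fin 4 =>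
        ∑ i, entry (b i) ^ 2 < 3 / 8 * Fintype.card ι).card : ℝ)
      ≤ 4 ^ Fintype.card ι * Real.exp (-(1 / 32) * Fintype.card ι) := by
  refine (card_lt_le_sum_exp _ _ (t := 1 / 2) (by norm_num)).trans ?_
  have hsum : ∑ b : ι → Fin 4, Real.exp (-(1 / 2) * ∑ i, entry (b i) ^ 2)
      = (∑ e : Fin 4, Real.exp (-(1 / 2) * entry e ^ 2)) ^ Fintype.card ι := by
    rw [← Finset.card_univ, ← Finset.prod_const, Finset.prod_univ_sum, Fintype.piFinset_univ]
    simp only [Finset.mul_sum, Real.exp_sum]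
  have hone : ∑ e : Fin 4, Real.exp (-(1 / 2) * entry e ^ 2) ≤ 4 * Real.exp (-(7 / 32)) := by
    have h := Real.cosh_le_exp_half_sq (1 / 4)
    rw [Real.cosh_eq] at h
    have h2 : ∑ e : Fin 4, Real.exp (-(1 / 2) * entry e ^ 2)
        = 4 * Real.exp (-(1 / 4)) * ((Real.exp (1 / 4) + Real.exp (-(1 / 4))) / 2) := by
      have h3 : Real.exp (-(1 / 2)) = Real.exp (-(1 / 4)) * Real.exp (-(1 / 4)) := by
        rw [← Real.exp_add]; norm_num
      have h4 : Real.exp (-(1 / 4)) * Real.exp (1 / 4) = 1 := by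
        rw [← Real.exp_add]; norm_num
      have h5 : ∑ e : Fin 4, Real.exp (-(1 / 2) * entry e ^ 2) = 2 + 2 * Real.exp (-(1 / 2)) := by
        simp only [Fin.sum_univ_four, entry]
        simp
        ring
      rw [h5, h3]
      linear_combination -2 * h4
    rw [h2]
    refine (mul_le_mul_of_nonneg_left h (by positivity)).trans_eq ?_
    rw [mul_assoc, ← Real.exp_add]
    norm_num
  simp only [Real.exp_add]
  rw [← Finset.mul_sum, hsum]
  calc _ ≤ Real.exp (1 / 2 * (3 / 8 * Fintype.card ι))
        * (4 * Real.exp (-(7 / 32))) ^ Fintype.card ι := by gcongr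
    _ = _ := by
      rw [mul_pow, ← Real.exp_nat_mul, mul_left_comm, ← Real.exp_add]
      ring_nf

lemma ofReal_le_xiMeasure {ι : Type*} [Fintype ι] [DecidableEq ι] (S : Set (ι → ℝ)) {p : ℝ}
    {bad : Finset (ι → Fin 4)} (hbad : ∀ b ∉ bad, (fun i => entry (b i)) ∈ S)
    (hp : (bad.card : ℝ) ≤ (1 - p) * 4 ^ Fintype.card ι) :
    ENNReal.ofReal p ≤ xiMeasure ι S := by
  classical
  refine le_trans ?_ (PMF.toOuterMeasure_apply_le_toMeasure_apply _ _)
  rw [PMF.toOuterMeasure_map_apply, PMF.toOuterMeasure_uniformOfFintype_apply]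
  have hsub : badᶜ.card ≤ Fintype.card
      ((fun b i => (![0, 0, 1, -1] : Fin 4 → ℝ) (b i)) ⁻¹' S : Set (ι → Fin 4)) := by
    rw [← Set.toFinset_card]
    refine Finset.card_le_card fun b hb => ?_
    rw [Set.mem_toFinset]
    exact hbad b (Finset.mem_compl.1 hb)
  have hcard : Fintype.card (ι → Fin 4) = 4 ^ Fintype.card ι := by simp
  have hc : (badᶜ.card : ℝ) = 4 ^ Fintype.card ι - bad.card := by
    rw [Finset.card_compl, Nat.cast_sub (Finset.card_le_univ _), hcard]
    push_cast
    rfl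
  have hle : p ≤ badᶜ.card / 4 ^ Fintype.card ι := by
    rw [le_div_iff₀ (by positivity), hc]
    linarith
  refine (ENNReal.ofReal_le_ofReal hle).trans ?_
  rw [ENNReal.ofReal_div_of_pos (by positivity), ENNReal.ofReal_natCast, hcard,
    ENNReal.ofReal_pow (by norm_num)]
  push_cast
  rw [ENNReal.ofReal_ofNat]
  gcongr

lemma weightedGram_apply {m l : Type*} [Fintype m] [DecidableEq m] (w : m → ℝ) (U : Matrix m l ℝ)
    (i j : l) : (Uᵀ * diagonal w * U) i j = ∑ a, U a i * w a * U a j := by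
  rw [mul_apply]
  simp [mul_diagonal]

lemma kronFamily_weightedGram {r : Fin n → ℕ} (w : ∀ k, Fin (d k) → ℝ)
    (U : ∀ k, Matrix (Fin (d k)) (Fin (r k)) ℝ) :
    kronFamily (fun k => (U k)ᵀ * diagonal (w k) * U k)
      = (of fun (a : Index d) (i : ∀ k, Fin (r k)) => ∏ k, U k (a k) (i k))ᵀ
        * diagonal (outer w) * of fun (a : Index d) (i : ∀ k, Fin (r k)) => ∏ k, U k (a k) (i k) := by
  ext i j
  rw [weightedGram_apply]
  simp only [kronFamily, weightedGram_apply, of_apply, outer, ← Finset.prod_mul_distrib]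
  rw [Finset.prod_univ_sum, Fintype.piFinset_univ]

lemma kronFamily_posSemidef {r : Fin n → ℕ} {w : ∀ k, Fin (d k) → ℝ} (hw : ∀ k i, 0 ≤ w k i)
    (U : ∀ k, Matrix (Fin (d k)) (Fin (r k)) ℝ) :
    (kronFamily fun k => (U k)ᵀ * diagonal (w k) * U k).PosSemidef := by
  rw [kronFamily_weightedGram, ← conjTranspose_eq_transpose_of_trivial]
  exact (PosSemidef.diagonal fun a => Finset.prod_nonneg fun k _ => hw k _).conjTranspose_mul_mul_same _

lemma kronFamily_diag {r : Fin n → ℕ} {w : ∀ k, Fin (d k) → ℝ} (hw : ∀ k i, 0 ≤ w k i)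
    {U : ∀ k, Matrix (Fin (d k)) (Fin (r k)) ℝ} (hU : ∀ k i j, U k i j = 1 ∨ U k i j = -1)
    (i : ∀ k, Fin (r k)) :
    kronFamily (fun k => (U k)ᵀ * diagonal (w k) * U k) i i = ∏ k, l1 (w k) := by
  simp only [kronFamily, weightedGram_apply]
  refine Finset.prod_congr rfl fun k _ => ?_
  refine Finset.sum_congr rfl fun a _ => ?_
  rw [abs_of_nonneg (hw k a)]
  rcases hU k a (i k) with h | h <;> rw [h] <;> ring

theorem quadratic_form_lower_bound :
    ∃ c' c'' : ℝ, 0 < c' ∧ 0 < c'' ∧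
    ∀ (n : ℕ) (d r : Fin n → ℕ) (w : ∀ k, Fin (d k) → ℝ), (∀ k i, 0 ≤ w k i) →
    ∀ U : ∀ k, Matrix (Fin (d k)) (Fin (r k)) ℝ,
      (∀ k i j, U k i j = 1 ∨ U k i j = -1) →
      matFrob (kronFamily (fun k => (U k)ᵀ * Matrix.diagonal (w k) * U k)
          - (∏ k, l1 (w k)) • (1 : Matrix (∀ k, Fin (r k)) (∀ k, Fin (r k)) ℝ)) ^ 2
        ≤ (∏ k, (2 * (r k : ℝ) ^ 2 * l2 (w k) ^ 2 + (r k : ℝ) * l1 (w k) ^ 2))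
          - (∏ k, ((r k : ℝ) * l1 (w k) ^ 2)) →
      specNorm (kronFamily (fun k => (U k)ᵀ * Matrix.diagonal (w k) * U k)
          - (∏ k, l1 (w k)) • (1 : Matrix (∀ k, Fin (r k)) (∀ k, Fin (r k)) ℝ))
        ≤ max ((∏ k, (2 * l2 (w k) * Real.sqrt ((r k : ℝ) * Real.log (r k)) +
              2 * linf (w k) * (r k : ℝ) * Real.log (r k) + l1 (w k))) - ∏ k, l1 (w k))
            (∏ k, l1 (w k)) →
      ENNReal.ofReal (1 - 2 * Real.exp (-c'' * ∏ k, (r k : ℝ))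
          - 2 * Real.exp (-c' * min
              ((∏ k, ((r k : ℝ) * l1 (w k) ^ 2)) /
                ((∏ k, (2 * (r k : ℝ) * l2 (w k) ^ 2 + l1 (w k) ^ 2)) - ∏ k, l1 (w k) ^ 2))
              (min (∏ k, (r k : ℝ))
                ((∏ k, ((r k : ℝ) * l1 (w k))) /
                  ((∏ k, (2 * l2 (w k) * Real.sqrt ((r k : ℝ) * Real.log (r k)) +
                      2 * linf (w k) * (r k : ℝ) * Real.log (r k) + l1 (w k)))
                    - ∏ k, l1 (w k)))))) ≤
        xiMeasure (∀ k, Fin (r k)) {ξ : (∀ k, Fin (r k)) → ℝ |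
          (∏ k, ((r k : ℝ) * l1 (w k))) ≤
            4 * (ξ ⬝ᵥ (kronFamily (fun k => (U k)ᵀ * Matrix.diagonal (w k) * U k)).mulVec ξ)} := by
  refine ⟨1 / 1024, 1 / 32, by norm_num, by norm_num, ?_⟩
  intro n d r w hw U hU hF _
  set A := kronFamily fun k => (U k)ᵀ * Matrix.diagonal (w k) * U k with hA
  set P := ∏ k, l1 (w k) with hP
  set G := (∏ k, (2 * (r k : ℝ) * l2 (w k) ^ 2 + l1 (w k) ^ 2)) - ∏ k, l1 (w k) ^ 2 with hG
  set R := ∏ k, (r k : ℝ) with hR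
  suffices h : ∀ m, m ≤ (∏ k, ((r k : ℝ) * l1 (w k) ^ 2)) / G → m ≤ R →
      ENNReal.ofReal (1 - 2 * Real.exp (-(1 / 32) * R) - 2 * Real.exp (-(1 / 1024) * m)) ≤
        xiMeasure (∀ k, Fin (r k)) {ξ : (∀ k, Fin (r k)) → ℝ |
          ∏ k, ((r k : ℝ) * l1 (w k)) ≤ 4 * (ξ ⬝ᵥ A.mulVec ξ)} from
    h _ (min_le_left _ _) ((min_le_right _ _).trans (min_le_left _ _))
  intro m hm1 hm2
  have hl1 : ∀ k, 0 ≤ l1 (w k) := fun k => Finset.sum_nonneg fun _ _ => abs_nonneg _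
  have hP0 : 0 ≤ P := Finset.prod_nonneg fun k _ => hl1 k
  have hRcard : (Fintype.card (∀ k, Fin (r k)) : ℝ) = R := by
    simp [hR, Fintype.card_pi]
  have hR0 : 0 ≤ R := by rw [← hRcard]; positivity
  have hG0 : 0 ≤ G := by
    rw [hG, sub_nonneg]
    refine Finset.prod_le_prod (fun k _ => sq_nonneg _) fun k _ => ?_
    have : 0 ≤ 2 * (r k : ℝ) * l2 (w k) ^ 2 := by positivity
    linarith
  have hPR : ∏ k, ((r k : ℝ) * l1 (w k)) = R * P := Finset.prod_mul_distrib
  have hPPR : ∏ k, ((r k : ℝ) * l1 (w k) ^ 2) = R * P ^ 2 := by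
    rw [Finset.prod_mul_distrib, Finset.prod_pow]
  rw [hPPR] at hm1
  rcases le_or_gt m 0 with hm0 | hm0
  · rw [ENNReal.ofReal_eq_zero.2]
    · exact zero_le
    · have h1 : 1 ≤ Real.exp (-(1 / 1024) * m) := Real.one_le_exp (by linarith)
      have h2 := Real.exp_pos (-(1 / 32) * R)
      linarith
  have hquot := hm0.trans_le hm1
  have hGpos : 0 < G := hG0.lt_of_ne fun h => by simp [← h] at hquot
  have hPpos : 0 < P := hP0.lt_of_ne fun h => by simp [← h] at hquot
  set E := A - P • (1 : Matrix (∀ k, Fin (r k)) (∀ k, Fin (r k)) ℝ) with hE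
  have hAE : E + P • (1 : Matrix (∀ k, Fin (r k)) (∀ k, Fin (r k)) ℝ) = A := sub_add_cancel _ _
  have hApsd : A.PosSemidef := kronFamily_posSemidef hw U
  have hEh : E.IsHermitian := hApsd.1.sub (by simp [IsHermitian])
  have hE0 : ∀ i, E i i = 0 := fun i => by
    have := kronFamily_diag hw hU i
    simp [hE, hA, this, hP]
  have hFE : ∑ i, ∑ j, E i j ^ 2 ≤ R * G := by
    rw [matFrob, Real.sq_sqrt (by positivity), hPPR] at hF
    refine hF.trans_eq ?_
    rw [hG, mul_sub, hR, ← Finset.prod_mul_distrib, Finset.prod_pow]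
    congr 1
    exact Finset.prod_congr rfl fun k _ => by ring
  set t := min (P / (64 * G)) (1 / (4 * P)) with ht
  have ht0 : 0 ≤ t := le_min (by positivity) (by positivity)
  have htP : t * P ≤ 1 / 4 := by
    calc t * P ≤ 1 / (4 * P) * P := by gcongr; exact min_le_right _ _
      _ = 1 / 4 := by field_simp
  have htG : t * G ≤ P / 64 := by
    calc t * G ≤ P / (64 * G) * G := by gcongr; exact min_le_left _ _
      _ = P / 64 := by field_simp
  have hmt : 1 / 1024 * m ≤ t * (P * R) / 16 := by
    rcases min_cases (P / (64 * G)) (1 / (4 * P)) with ⟨h, _⟩ | ⟨h, _⟩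
    · rw [ht, h]
      refine (mul_le_mul_of_nonneg_left hm1 (by norm_num)).trans_eq ?_
      field_simp
      linarith
    · rw [ht, h]
      have : 1 / (4 * P) * (P * R) / 16 = R / 64 := by field_simp; ring
      rw [this]
      linarith
  have hexp : t * -(P * R / 8) + 4 * t ^ 2 * ∑ i, ∑ j, E i j ^ 2 ≤ -(1 / 1024) * m := by
    have : t ^ 2 * ∑ i, ∑ j, E i j ^ 2 ≤ t * R * (P / 64) := by
      calc t ^ 2 * ∑ i, ∑ j, E i j ^ 2 ≤ t ^ 2 * (R * G) := by gcongr
        _ = t * R * (t * G) := by ring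
        _ ≤ _ := by gcongr
    linarith
  classical
  refine ofReal_le_xiMeasure _
    (bad := (Finset.univ.filter fun b : (∀ k, Fin (r k)) → Fin 4 =>
        ∑ i, entry (b i) ^ 2 < 3 / 8 * Fintype.card (∀ k, Fin (r k))) ∪
      Finset.univ.filter fun b : (∀ k, Fin (r k)) → Fin 4 =>
        (fun i => entry (b i)) ⬝ᵥ E *ᵥ (fun i => entry (b i)) < -(P * R / 8)) ?_ ?_
  · intro b hb
    simp only [Finset.mem_union, Finset.mem_filter, Finset.mem_univ, true_and, not_or, not_lt,
      hRcard] at hb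
    obtain ⟨hb1, hb2⟩ := hb
    have hquad : (fun i => entry (b i)) ⬝ᵥ A *ᵥ (fun i => entry (b i))
        = (fun i => entry (b i)) ⬝ᵥ E *ᵥ (fun i => entry (b i)) + P * ∑ i, entry (b i) ^ 2 := by
      rw [← hAE, add_mulVec, dotProduct_add, smul_mulVec, one_mulVec, dotProduct_smul, smul_eq_mul]
      simp [dotProduct, sq]
    rw [Set.mem_ofPred_eq, hPR, hquad]
    nlinarith [mul_le_mul_of_nonneg_left hb1 hP0]
  · have h1 := card_sum_sq_lt_le (∀ k, Fin (r k))
    have h2 := card_lt_le_sum_exp (fun b : (∀ k, Fin (r k)) → Fin 4 =>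
      (fun i => entry (b i)) ⬝ᵥ E *ᵥ (fun i => entry (b i))) (-(P * R / 8)) ht0
    have h3 := sum_exp_neg_quadForm_le (P := P) hEh hE0 (by rwa [hAE]) ht0 htP
    simp only [Real.exp_add, ← Finset.mul_sum] at h2
    have h4 := h2.trans (mul_le_mul_of_nonneg_left h3 (Real.exp_pos _).le)
    rw [mul_left_comm, ← Real.exp_add] at h4
    have h5 := h4.trans (mul_le_mul_of_nonneg_left (Real.exp_le_exp.2 hexp) (by positivity))
    refine (Nat.cast_le.2 (Finset.card_union_le _ _)).trans ?_
    push_cast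
    refine (add_le_add h1 h5).trans ?_
    rw [hRcard, ← mul_add, mul_comm]
    gcongr
    have := Real.exp_pos (-(1 / 32) * R)
    have := Real.exp_pos (-(1 / 1024) * m)
    linarith

end WTC
end

section
/- For every C' ≥ 1 there exist constants c, C > 0 depending only on C' such that the following holds for all sufficiently large d₁,…,dₙ and r₁,…,rₙ. Let W = w₁⊗⋯⊗wₙ ∈ ℝ^{d₁×⋯×dₙ} be a CP rank-one tensor with ‖W‖_∞ ≤ 1 and max_{i_k}|w_k(i_k)| ≤ C'·min_{i_k}|w_k(i_k)| for all k = 1,…,n, and let Ω ∼ W be a random subset of [d₁]×⋯×[dₙ] (each tuple included independently with probability W_{i₁⋯iₙ}). Set m = ‖W^{(1/2)}‖_F². Then with probability at least 1 − exp(−C·m) over the choice of Ω the following holds: for every σ, β > 0 and every measurable map A : ℝ^Ω → ℝ^{d₁×⋯×dₙ}, there exists a tensor T of Tucker rank at most r = (r₁,…,rₙ) with ‖T‖_∞ ≤ β such that, with probability at least 1/2 over the choice of Z with i.i.d. N(0,σ²) entries, ‖W^{(1/2)}∘(A(T_Ω + Z_Ω) − T)‖_F / ‖W^{(1/2)}‖_F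 ≥ c·min{ β/√(log(8∏_{k=1}^n d_k)), (σ/√|Ω|)·√(∏_{k=1}^n r_k)·min{ 1/√((∏_{k=1}^n (1 + 2C'²r_k/d_k)) − 1), 1, 1/√((∏_{k=1}^n (2C'√((r_k/d_k)·log r_k) + 2C'(r_k/d_k)·log r_k + 1)) − 1) } }. -/
open MeasureTheory ProbabilityTheory Matrix
open scoped BigOperators ENNReal

namespace WTC

variable {n : ℕ}

variable {d : Fin n → ℕ}

/-! ### Gaussian shifts -/

/-- Likelihood ratio of `N(h, v)` with respect to `N(0, v)`. -/
noncomputable def gaussianLR (v : NNReal) (h x : ℝ) : ℝ≥0∞ :=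
  ENNReal.ofReal (Real.exp (h * x / v - h ^ 2 / (2 * v)))

lemma measurable_gaussianLR (v : NNReal) (h : ℝ) : Measurable (gaussianLR v h) := by
  unfold gaussianLR
  fun_prop

lemma gaussianReal_eq_withDensity_gaussianLR {v : NNReal} (hv : v ≠ 0) (h : ℝ) :
    gaussianReal h v = (gaussianReal 0 v).withDensity (gaussianLR v h) := by
  have hv' : (v : ℝ) ≠ 0 := by exact_mod_cast hv
  rw [gaussianReal_of_var_ne_zero _ hv, gaussianReal_of_var_ne_zero _ hv,
    ← withDensity_mul _ (measurable_gaussianPDF _ _) (measurable_gaussianLR v h)]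
  congr 1
  ext x
  simp only [Pi.mul_apply, gaussianPDF, gaussianLR, gaussianPDFReal]
  rw [← ENNReal.ofReal_mul (by positivity), mul_assoc (√(2 * Real.pi * v))⁻¹, ← Real.exp_add]
  congr 3
  field_simp
  ring

lemma lintegral_gaussianLR_sq {v : NNReal} (hv : v ≠ 0) (h : ℝ) :
    ∫⁻ x, gaussianLR v h x ^ 2 ∂(gaussianReal 0 v) = ENNReal.ofReal (Real.exp (h ^ 2 / v)) := by
  have hv' : (v : ℝ) ≠ 0 := by exact_mod_cast hv
  have e : ∀ x, gaussianLR v h x ^ 2 =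
      ENNReal.ofReal (Real.exp (-(h ^ 2 / v)) * Real.exp (2 * h / v * x)) := by
    intro x
    rw [gaussianLR, ← ENNReal.ofReal_pow (by positivity), ← Real.exp_add, ← Real.exp_nat_mul]
    congr 2
    push_cast
    field_simp
    ring
  simp_rw [e]
  rw [← ofReal_integral_eq_lintegral_ofReal
    ((integrable_exp_mul_gaussianReal _).const_mul _) (ae_of_all _ fun x => by positivity),
    integral_const_mul]
  have := congrFun (mgf_fun_id_gaussianReal (μ := 0) (v := v)) (2 * h / v)
  rw [mgf] at this
  rw [this, ← Real.exp_add]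
  congr 2
  field_simp
  ring

section PiGaussian

variable {ι : Type*} [Fintype ι]

lemma lintegral_prod_pi_gaussian (v : NNReal) (g : ι → ℝ → ℝ≥0∞) (hg : ∀ i, Measurable (g i)) :
    ∫⁻ z, ∏ i, g i (z i) ∂(Measure.pi fun _ : ι => gaussianReal 0 v)
      = ∏ i, ∫⁻ x, g i x ∂(gaussianReal 0 v) := by
  have hi : iIndepFun (fun (i : ι) (z : ι → ℝ) => g i (z i))
      (Measure.pi fun _ : ι => gaussianReal 0 v) :=
    iIndepFun_pi (fun i => (hg i).aemeasurable)
  rw [lintegral_prod_eq_prod_lintegral_of_indepFun _ (fun i (z : ι → ℝ) => g i (z i)) hi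
    (fun i => (hg i).comp (measurable_pi_apply i))]
  refine Finset.prod_congr rfl fun i _ => ?_
  exact (measurePreserving_eval (fun _ : ι => gaussianReal 0 v) i).lintegral_comp (hg i)

lemma map_add_pi_gaussian {v : NNReal} (hv : v ≠ 0) (h : ι → ℝ) :
    (Measure.pi fun _ : ι => gaussianReal 0 v).map (fun z => z + h)
      = (Measure.pi fun _ : ι => gaussianReal 0 v).withDensity
          fun z => ∏ i, gaussianLR v (h i) (z i) := by
  have h1 : (Measure.pi fun _ : ι => gaussianReal 0 v).map (fun z => z + h)
      = Measure.pi fun i => gaussianReal (h i) v := by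
    have := Measure.pi_map_pi (μ := fun _ : ι => gaussianReal 0 v)
      (f := fun i x => x + h i) (fun i => by fun_prop)
    simp only [gaussianReal_map_add_const, zero_add] at this
    exact this
  rw [h1]
  refine Measure.pi_eq fun s hs => ?_
  rw [withDensity_apply _ (MeasurableSet.univ_pi hs),
    ← lintegral_indicator (MeasurableSet.univ_pi hs)]
  have e : ∀ z : ι → ℝ, (Set.univ.pi s).indicator (fun z => ∏ i, gaussianLR v (h i) (z i)) z
      = ∏ i, (s i).indicator (gaussianLR v (h i)) (z i) := by
    intro z
    by_cases hz : z ∈ Set.univ.pi s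
    · rw [Set.indicator_of_mem hz]
      exact Finset.prod_congr rfl fun i _ => (Set.indicator_of_mem (hz i trivial) _).symm
    · rw [Set.indicator_of_notMem hz]
      simp only [Set.mem_pi, not_forall] at hz
      obtain ⟨i, _, hi⟩ := hz
      exact (Finset.prod_eq_zero (Finset.mem_univ i) (Set.indicator_of_notMem hi _)).symm
  simp_rw [e]
  rw [lintegral_prod_pi_gaussian v _ fun i => (measurable_gaussianLR v (h i)).indicator (hs i)]
  refine Finset.prod_congr rfl fun i _ => ?_
  rw [lintegral_indicator (hs i), gaussianReal_eq_withDensity_gaussianLR hv (h i),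
    withDensity_apply _ (hs i)]

/-- Second-moment change of measure for a shifted Gaussian vector. -/
lemma six_mul_pi_gaussian_shift_le {v : NNReal} (hv : v ≠ 0) (h : ι → ℝ) {E : Set (ι → ℝ)}
    (hE : MeasurableSet E) (κ : ℝ) (hκ : (∑ i, h i ^ 2) / v ≤ κ) :
    6 * (Measure.pi fun _ : ι => gaussianReal 0 v) {z | z + h ∈ E}
      ≤ 9 * (Measure.pi fun _ : ι => gaussianReal 0 v) E + ENNReal.ofReal (Real.exp κ) := by
  set ν := Measure.pi fun _ : ι => gaussianReal 0 v with hν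
  set L : (ι → ℝ) → ℝ≥0∞ := fun z => ∏ i, gaussianLR v (h i) (z i) with hL
  have hLm : Measurable L :=
    Finset.measurable_prod _ fun i _ => (measurable_gaussianLR v (h i)).comp (measurable_pi_apply i)
  have hsq : ∫⁻ z, L z ^ 2 ∂ν ≤ ENNReal.ofReal (Real.exp κ) := by
    simp_rw [hL, ← Finset.prod_pow]
    rw [hν, lintegral_prod_pi_gaussian v (fun i x => gaussianLR v (h i) x ^ 2)
      fun i => (measurable_gaussianLR v (h i)).pow_const 2]
    simp_rw [lintegral_gaussianLR_sq hv]
    rw [← ENNReal.ofReal_prod_of_nonneg fun i _ => by positivity, ← Real.exp_sum, ← Finset.sum_div]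
    exact ENNReal.ofReal_le_ofReal (Real.exp_le_exp.2 hκ)
  have hm : ν {z | z + h ∈ E} = ∫⁻ z in E, L z ∂ν := by
    have h2 : ν {z | z + h ∈ E} = ν.map (fun z => z + h) E :=
      (Measure.map_apply (by fun_prop) hE).symm
    rw [h2, map_add_pi_gaussian hv, withDensity_apply _ hE]
  have hpt : ∀ z, 6 * L z ≤ 9 + L z ^ 2 := by
    intro z
    have hfin : L z ≠ ∞ := ENNReal.prod_ne_top fun i _ => ENNReal.ofReal_ne_top
    generalize L z = x at hfin
    lift x to NNReal using hfin
    have : 6 * x ≤ 9 + x ^ 2 := by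
      rw [← NNReal.coe_le_coe]
      push_cast
      nlinarith [sq_nonneg ((x : ℝ) - 3)]
    exact_mod_cast this
  calc 6 * ν {z | z + h ∈ E} = ∫⁻ z in E, 6 * L z ∂ν := by rw [hm, lintegral_const_mul _ hLm]
    _ ≤ ∫⁻ z in E, 9 + L z ^ 2 ∂ν := lintegral_mono fun z => hpt z
    _ = 9 * ν E + ∫⁻ z in E, L z ^ 2 ∂ν := by
        rw [lintegral_add_left measurable_const, setLIntegral_const]
    _ ≤ 9 * ν E + ENNReal.ofReal (Real.exp κ) := by
        gcongr
        exact (setLIntegral_le_lintegral _ _).trans hsq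

/-- A scalar estimator cannot localise nine equally spaced, statistically close means. -/
lemma sum_nine_levels_le {v : NNReal} (hv : v ≠ 0) (h : ι → ℝ)
    (hh : 256 * ((∑ i, h i ^ 2) / v) ≤ 1) {a : ℝ} {F : (ι → ℝ) → ℝ}
    (hF : Measurable F) :
    ∑ k : Fin 9, (Measure.pi fun _ : ι => gaussianReal 0 v).real
        {z | |F (z + (k : ℝ) • h) - a * (k : ℝ)| < a / 2} ≤ 3.45 := by
  set ν := Measure.pi fun _ : ι => gaussianReal 0 v with hν
  set E : Fin 9 → Set (ι → ℝ) := fun k => {y | |F y - a * (k : ℝ)| < a / 2} with hE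
  have hEm : ∀ k, MeasurableSet (E k) := fun k =>
    measurableSet_lt (by fun_prop) measurable_const
  have hdisj : Pairwise (Function.onFun Disjoint E) := by
    intro k l hkl
    refine Set.disjoint_left.2 fun y hk hl => hkl ?_
    simp only [hE, Set.mem_ofPred_eq, abs_lt] at hk hl
    have ha : 0 < a := by linarith
    by_contra hne
    rcases lt_or_gt_of_ne hne with hlt | hlt
    · have : ((k : ℕ) : ℝ) + 1 ≤ ((l : ℕ) : ℝ) := by exact_mod_cast hlt
      nlinarith
    · have : ((l : ℕ) : ℝ) + 1 ≤ ((k : ℕ) : ℝ) := by exact_mod_cast hlt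
      nlinarith
  have hEsum : ∑ k, ν.real (E k) ≤ 1 := by
    rw [← measureReal_iUnion_fintype hdisj hEm]
    exact measureReal_le_one
  have hexp : Real.exp (1 / 4) ≤ 1.3 := by
    have h4 : Real.exp (1 / 4) ^ 4 = Real.exp 1 := by
      rw [← Real.exp_nat_mul]; norm_num
    refine le_of_pow_le_pow_left₀ (n := 4) (by norm_num) (by norm_num) ?_
    rw [h4]
    exact Real.exp_one_lt_d9.le.trans (by norm_num)
  have hk : ∀ k : Fin 9, 6 * ν.real {z | |F (z + (k : ℝ) • h) - a * (k : ℝ)| < a / 2}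
      ≤ 9 * ν.real (E k) + 1.3 := by
    intro k
    have hκ : (∑ i, ((k : ℝ) • h) i ^ 2) / v ≤ 1 / 4 := by
      have e : (∑ i, ((k : ℝ) • h) i ^ 2) / v = (k : ℝ) ^ 2 * ((∑ i, h i ^ 2) / v) := by
        simp [mul_pow, ← Finset.mul_sum, mul_div_assoc]
      have hk8 : ((k : ℕ) : ℝ) ≤ 8 := by exact_mod_cast Nat.lt_succ_iff.1 k.2
      have hk64 : ((k : ℕ) : ℝ) ^ 2 ≤ 64 := by
        have : (0 : ℝ) ≤ ((k : ℕ) : ℝ) := by positivity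
        nlinarith
      have h0 : 0 ≤ (∑ i, h i ^ 2) / v := by positivity
      rw [e]
      nlinarith
    have := six_mul_pi_gaussian_shift_le hv ((k : ℝ) • h) (hEm k) (1 / 4) hκ
    have h2 := ENNReal.toReal_mono (by finiteness) this
    rw [ENNReal.toReal_add (by finiteness) (by finiteness),
      ENNReal.toReal_mul, ENNReal.toReal_mul,
      ENNReal.toReal_ofReal (Real.exp_pos _).le] at h2
    simp only [ENNReal.toReal_ofNat] at h2
    have : 6 * ν.real {z | z + (k : ℝ) • h ∈ E k} ≤ 9 * ν.real (E k) + 1.3 := h2.trans (by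
      rw [measureReal_def]; linarith)
    exact this
  have := Finset.sum_le_sum fun k (_ : k ∈ Finset.univ) => hk k
  rw [← Finset.mul_sum, Finset.sum_add_distrib, ← Finset.mul_sum] at this
  simp only [Finset.sum_const, Finset.card_univ, Fintype.card_fin, nsmul_eq_mul] at this
  push_cast at this
  linarith

end PiGaussian

/-! ### Tensors that are constant on product blocks -/

/-- The block containing the index `i`, when mode `k` is partitioned by `f k`. -/
def blockMap {r : Fin n → ℕ} (f : ∀ k, Fin (d k) → Fin (r k)) (i : Index d) : Index r :=
  fun k => f k (i k)

lemma tuckerRankLE_blockMap {r : Fin n → ℕ} (f : ∀ k, Fin (d k) → Fin (r k)) (G : Tensor r) :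
    TuckerRankLE (fun i => G (blockMap f i)) r := by
  intro k
  have e : matricize k (fun i => G (blockMap f i)) =
      (matricize k G).submatrix (f k)
        (fun (rest : RestIdx d k) (j : {j : Fin n // j ≠ k}) => f j.1 (rest j)) := by
    ext x rest
    simp only [matricize, Matrix.submatrix_apply]
    congr 1
    funext j
    by_cases hj : j = k
    · subst hj
      simp [blockMap, embed]
    · simp [blockMap, embed, hj]
  rw [e]
  exact (Matrix.rank_submatrix_le _ _ _).trans
    ((Matrix.rank_le_card_height _).trans (by simp))

/-- Upper bound for the number of colourings of `[p]` with `q` colours giving `a` and `b` the same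
colour. -/
lemma mul_sum_ite_eq_le {p q : ℕ} (a b : Fin p) :
    (q : ℝ) * ∑ g : Fin p → Fin q, (if g a = g b then (1 : ℝ) else 0)
      ≤ (q : ℝ) ^ p * (1 + if a = b then (q : ℝ) else 0) := by
  rw [Finset.sum_boole]
  by_cases hab : a = b
  · simp only [hab, if_true, Finset.filter_true, Finset.card_univ, Fintype.card_fun,
      Fintype.card_fin, Nat.cast_pow]
    nlinarith [show (0 : ℝ) ≤ (q : ℝ) ^ p by positivity]
  · have hcard : q * (Finset.univ.filter fun g : Fin p → Fin q => g a = g b).card ≤ q ^ p := by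
      have := Finset.card_le_card_of_injOn
        (s := (Finset.univ : Finset (Fin q)) ×ˢ
          (Finset.univ.filter fun g : Fin p → Fin q => g a = g b))
        (t := (Finset.univ : Finset (Fin p → Fin q)))
        (fun x => Function.update x.2 a x.1) (fun _ _ => Finset.mem_univ _) (by
          rintro ⟨c, g⟩ hg ⟨c', g'⟩ hg' h
          simp only [Finset.coe_product, Set.mem_prod, Finset.mem_coe, Finset.mem_filter,
            Finset.mem_univ, true_and] at hg hg'
          have hx : ∀ x, Function.update g a c x = Function.update g' a c' x := congrFun h
          have hc : c = c' := by simpa using hx a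
          have hne : ∀ x, x ≠ a → g x = g' x := fun x hxa => by simpa [hxa] using hx x
          have hg0 : g = g' := by
            funext x
            by_cases hxa : x = a
            · rw [hxa, hg, hg', hne b (Ne.symm hab)]
            · exact hne x hxa
          rw [hc, hg0])
      simpa using this
    simp only [hab, if_false, add_zero, mul_one]
    exact_mod_cast hcard

lemma sum_ite_blockMap_eq {r : Fin n → ℕ} (i j : Index d) :
    ∑ f : (∀ k, Fin (d k) → Fin (r k)), (if blockMap f i = blockMap f j then (1 : ℝ) else 0)
      = ∏ k, ∑ g : Fin (d k) → Fin (r k), (if g (i k) = g (j k) then (1 : ℝ) else 0) := by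
  rw [Finset.prod_univ_sum, Fintype.piFinset_univ]
  refine Finset.sum_congr rfl fun f _ => ?_
  rw [Finset.prod_ite_zero]
  simp [blockMap, funext_iff]

/-- The number of sampled indices in the block of `i`. -/
noncomputable def blockCount {r : Fin n → ℕ} (f : ∀ k, Fin (d k) → Fin (r k))
    (ω : Index d → Bool) (b : Index r) : ℝ :=
  ∑ i, bindic ω i * (if blockMap f i = b then 1 else 0)

lemma sum_bindic (ω : Index d → Bool) : ∑ i, bindic ω i = (patCard ω : ℝ) := by
  simp [bindic, patCard]

lemma sum_abs_outer (w : ∀ j, Fin (d j) → ℝ) :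
    ∑ i : Index d, ∏ k, |w k (i k)| = ∏ k, ∑ x, |w k x| := by
  rw [Finset.prod_univ_sum, Fintype.piFinset_univ]

lemma sum_sum_le_of_flat {r : Fin n → ℕ} (hr : ∀ k, 1 ≤ r k) (hd : ∀ k, 1 ≤ d k) {C' : ℝ}
    (w : ∀ j, Fin (d j) → ℝ)
    (hflat : ∀ (k : Fin n) (i i' : Fin (d k)), |w k i| ≤ C' * |w k i'|) (i : Index d) :
    ∑ f : (∀ k, Fin (d k) → Fin (r k)),
      ∑ j : Index d, (∏ k, |w k (j k)|) * (if blockMap f i = blockMap f j then (1 : ℝ) else 0)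
      ≤ (Fintype.card (∀ k, Fin (d k) → Fin (r k)) : ℝ) *
        ((∑ j : Index d, ∏ k, |w k (j k)|) * (∏ k, (1 + C' * (r k : ℝ) / (d k : ℝ)))
          / ∏ k, (r k : ℝ)) := by
  have hr0 : ∀ k, (0 : ℝ) < r k := fun k => by exact_mod_cast hr k
  have hd0 : ∀ k, (0 : ℝ) < d k := fun k => by exact_mod_cast hd k
  have hmax : ∀ (k : Fin n) (x : Fin (d k)), d k * |w k x| ≤ C' * ∑ y, |w k y| := by
    intro k x
    rw [Finset.mul_sum]
    have := Finset.sum_le_sum fun y (_ : y ∈ Finset.univ) => hflat k x y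
    simpa using this
  have hk : ∀ k, ∑ x : Fin (d k), |w k x| *
      ∑ g : Fin (d k) → Fin (r k), (if g (i k) = g x then (1 : ℝ) else 0)
      ≤ (r k : ℝ) ^ d k * ((∑ x, |w k x|) * (1 + C' * (r k : ℝ) / (d k : ℝ)) / r k) := by
    intro k
    have h1 : ∀ x : Fin (d k), |w k x| *
        ∑ g : Fin (d k) → Fin (r k), (if g (i k) = g x then (1 : ℝ) else 0)
        ≤ |w k x| * ((r k : ℝ) ^ d k * (1 + if i k = x then (r k : ℝ) else 0) / r k) := by
      intro x
      refine mul_le_mul_of_nonneg_left ?_ (abs_nonneg _)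
      rw [le_div_iff₀ (hr0 k), mul_comm]
      exact mul_sum_ite_eq_le _ _
    refine (Finset.sum_le_sum fun x _ => h1 x).trans ?_
    have h2 : ∑ x, |w k x| * ((r k : ℝ) ^ d k * (1 + if i k = x then (r k : ℝ) else 0) / r k)
        = (r k : ℝ) ^ d k * ((∑ x, |w k x| + r k * |w k (i k)|) / r k) := by
      have : ∀ x, |w k x| * ((r k : ℝ) ^ d k * (1 + if i k = x then (r k : ℝ) else 0) / r k)
          = (r k : ℝ) ^ d k / r k * |w k x| +
            (if i k = x then (r k : ℝ) ^ d k / r k * (r k * |w k x|) else 0) := by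
        intro x
        split_ifs <;> ring
      simp_rw [this]
      rw [Finset.sum_add_distrib, Finset.sum_ite_eq, ← Finset.mul_sum]
      simp only [Finset.mem_univ, if_true]
      ring
    rw [h2]
    have h3 : (r k : ℝ) * |w k (i k)| ≤ (∑ x, |w k x|) * (C' * (r k : ℝ) / (d k : ℝ)) := by
      rw [mul_div_assoc', le_div_iff₀ (hd0 k)]
      nlinarith [mul_le_mul_of_nonneg_left (hmax k (i k)) (hr0 k).le]
    have : (∑ x, |w k x| + r k * |w k (i k)|)
        ≤ (∑ x, |w k x|) * (1 + C' * (r k : ℝ) / (d k : ℝ)) := by linarith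
    have hr1 := hr0 k
    gcongr
  rw [Finset.sum_comm]
  simp_rw [← Finset.mul_sum, sum_ite_blockMap_eq, ← Finset.prod_mul_distrib]
  have hpi : ∑ j : Index d, ∏ k, (|w k (j k)| *
      ∑ g : Fin (d k) → Fin (r k), (if g (i k) = g (j k) then (1 : ℝ) else 0))
      = ∏ k, ∑ x : Fin (d k), |w k x| *
        ∑ g : Fin (d k) → Fin (r k), (if g (i k) = g x then (1 : ℝ) else 0) := by
    rw [Finset.prod_univ_sum, Fintype.piFinset_univ]
  rw [hpi]
  refine (Finset.prod_le_prod (fun k _ => Finset.sum_nonneg fun x _ => by positivity)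
    fun k _ => hk k).trans (le_of_eq ?_)
  rw [Finset.prod_mul_distrib, Finset.prod_div_distrib, Finset.prod_mul_distrib, sum_abs_outer]
  simp

/-- Some partition into product blocks has few weighted coincidences with the pattern `ω`. -/
lemma exists_blockMap_sum_le {r : Fin n → ℕ} (hr : ∀ k, 1 ≤ r k) (hd : ∀ k, 1 ≤ d k) {C' : ℝ}
    (w : ∀ j, Fin (d j) → ℝ)
    (hflat : ∀ (k : Fin n) (i i' : Fin (d k)), |w k i| ≤ C' * |w k i'|)
    (ω : Index d → Bool) :
    ∃ f : ∀ k, Fin (d k) → Fin (r k),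
      ∑ j : Index d, (∏ k, |w k (j k)|) * blockCount f ω (blockMap f j)
        ≤ (patCard ω : ℝ) * ((∑ j : Index d, ∏ k, |w k (j k)|) *
          (∏ k, (1 + C' * (r k : ℝ) / (d k : ℝ))) / ∏ k, (r k : ℝ)) := by
  have : ∀ k, Nonempty (Fin (r k)) := fun k => ⟨⟨0, hr k⟩⟩
  set B : ℝ := (∑ j : Index d, ∏ k, |w k (j k)|) *
    (∏ k, (1 + C' * (r k : ℝ) / (d k : ℝ))) / ∏ k, (r k : ℝ) with hB
  have key : ∑ f : (∀ k, Fin (d k) → Fin (r k)),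
      ∑ j : Index d, (∏ k, |w k (j k)|) * blockCount f ω (blockMap f j)
      ≤ ∑ f : (∀ k, Fin (d k) → Fin (r k)), (patCard ω : ℝ) * B := by
    have e : ∀ f : (∀ k, Fin (d k) → Fin (r k)),
        ∑ j : Index d, (∏ k, |w k (j k)|) * blockCount f ω (blockMap f j)
        = ∑ i, bindic ω i * ∑ j : Index d, (∏ k, |w k (j k)|) *
          (if blockMap f i = blockMap f j then (1 : ℝ) else 0) := by
      intro f
      simp_rw [blockCount, Finset.mul_sum]
      rw [Finset.sum_comm]
      refine Finset.sum_congr rfl fun i _ => Finset.sum_congr rfl fun j _ => ?_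
      ring
    simp_rw [e]
    rw [Finset.sum_comm]
    simp_rw [← Finset.mul_sum]
    rw [Finset.sum_const, nsmul_eq_mul, Finset.card_univ, ← sum_bindic, Finset.sum_mul]
    refine Finset.sum_le_sum fun i _ => ?_
    have := sum_sum_le_of_flat hr hd w hflat i
    have hb : 0 ≤ bindic ω i := by unfold bindic; split_ifs <;> norm_num
    exact mul_le_mul_of_nonneg_left this hb
  obtain ⟨f, -, hf⟩ := Finset.exists_le_of_sum_le Finset.univ_nonempty key
  exact ⟨f, hf⟩

/-! ### Averaging over the levels of a block tensor -/

lemma nine_mul_sum_levels {B : Type*} [Fintype B] [DecidableEq B] (b : B)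
    (φ : (B → Fin 9) → ℝ) :
    9 * ∑ e, φ e = ∑ e, ∑ l, φ (Function.update e b l) := by
  have h1 : ∀ l : Fin 9, ∑ e : B → Fin 9, φ (Function.update e b (e b + l)) = ∑ e, φ e := by
    intro l
    rw [← Equiv.sum_comp (Equiv.addRight (Pi.single b l : B → Fin 9)) φ]
    refine Finset.sum_congr rfl fun e _ => congrArg φ ?_
    funext x
    by_cases hx : x = b
    · subst hx; simp
    · simp [hx]
  have h2 : ∀ e : B → Fin 9, ∑ l, φ (Function.update e b (e b + l))
      = ∑ l, φ (Function.update e b l) := fun e =>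
    Equiv.sum_comp (Equiv.addLeft (e b)) fun l => φ (Function.update e b l)
  simp_rw [← h2]
  rw [Finset.sum_comm]
  simp_rw [h1]
  simp

lemma mul_measureReal_weighted_sum_ge_le {α ι : Type*} [MeasurableSpace α] [Fintype ι]
    (ν : Measure α) [IsProbabilityMeasure ν] (s : ι → Set α) (hs : ∀ i, MeasurableSet (s i))
    (q : ι → ℝ) (hq : ∀ i, 0 ≤ q i) (t : ℝ) :
    t * ν.real {z | t ≤ ∑ i, q i * (s i).indicator (fun _ => (1 : ℝ)) z}
      ≤ ∑ i, q i * ν.real (s i) := by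
  have hint : ∀ i, Integrable (fun z => q i * (s i).indicator (fun _ => (1 : ℝ)) z) ν :=
    fun i => ((integrable_const (1 : ℝ)).indicator (hs i)).const_mul _
  have h0 : ∀ z, 0 ≤ ∑ i, q i * (s i).indicator (fun _ => (1 : ℝ)) z := fun z =>
    Finset.sum_nonneg fun i _ => mul_nonneg (hq i) (Set.indicator_nonneg (fun _ _ => zero_le_one) _)
  refine (mul_meas_ge_le_integral_of_nonneg (ae_of_all _ h0)
    (integrable_finsetSum _ fun i _ => hint i) t).trans (le_of_eq ?_)
  rw [integral_finsetSum _ fun i _ => hint i]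
  refine Finset.sum_congr rfl fun i _ => ?_
  rw [integral_const_mul]
  congr 1
  exact integral_indicator_one (hs i)

/-- The block tensor with level `e b` and step `a b` on the block `b`. -/
noncomputable def levelTensor {r : Fin n → ℕ} (f : ∀ k, Fin (d k) → Fin (r k)) (a : Index r → ℝ)
    (e : Index r → Fin 9) : Tensor d :=
  fun i => a (blockMap f i) * (e (blockMap f i) : ℝ)

instance (σ : ℝ) : IsProbabilityMeasure (gaussianTensor d σ) := by
  unfold gaussianTensor; infer_instance

/-- Along the block of `i`, the estimate of entry `i` is close to few of the nine levels. -/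
lemma sum_level_close_le {r : Fin n → ℕ} (f : ∀ k, Fin (d k) → Fin (r k)) (a : Index r → ℝ)
    {σ : ℝ} (hσ : 0 < σ) (ω : Index d → Bool)
    (ha : ∀ b, 256 * (a b ^ 2 * blockCount f ω b) ≤ σ ^ 2) {A : Tensor d → Tensor d}
    (hA : Measurable A) (i : Index d) (e : Index r → Fin 9) :
    ∑ l, (gaussianTensor d σ).real {z | |A (fun i' => bindic ω i' *
        (levelTensor f a (Function.update e (blockMap f i) l) i' + z i')) i
          - levelTensor f a (Function.update e (blockMap f i) l) i| < a (blockMap f i) / 2}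
      ≤ 3.45 := by
  set b := blockMap f i with hb
  have hv : (σ ^ 2).toNNReal ≠ 0 := by
    rw [Ne, Real.toNNReal_eq_zero, not_le]; positivity
  set h : Index d → ℝ := fun i' => a b * (bindic ω i' * if blockMap f i' = b then 1 else 0) with hh
  have hsum : ∑ i', h i' ^ 2 = a b ^ 2 * blockCount f ω b := by
    rw [blockCount, Finset.mul_sum]
    refine Finset.sum_congr rfl fun i' _ => ?_
    simp only [hh, bindic]
    split_ifs <;> ring
  have h256 : 256 * ((∑ i', h i' ^ 2) / ((σ ^ 2).toNNReal : ℝ)) ≤ 1 := by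
    rw [hsum, Real.coe_toNNReal _ (by positivity), mul_div_assoc', div_le_one (by positivity)]
    exact ha b
  set F : Tensor d → ℝ := fun y => A (fun i' => bindic ω i' *
    (levelTensor f a (Function.update e b 0) i' + y i')) i with hF
  have hFm : Measurable F := by
    have h1 : Measurable fun y : Tensor d => (fun i' => bindic ω i' *
        (levelTensor f a (Function.update e b 0) i' + y i') : Tensor d) :=
      measurable_pi_lambda _ fun i' => by fun_prop
    exact (measurable_pi_apply i).comp (hA.comp h1)
  refine le_trans (le_of_eq ?_) (sum_nine_levels_le hv h h256 (a := a b) hFm)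
  refine Finset.sum_congr rfl fun l _ => ?_
  rw [gaussianTensor]
  congr 1
  ext z
  have e1 : (fun i' => bindic ω i' * (levelTensor f a (Function.update e b l) i' + z i'))
      = fun i' => bindic ω i' * (levelTensor f a (Function.update e b 0) i' +
          (z + (l : ℝ) • h) i') := by
    funext i'
    by_cases hi : blockMap f i' = b
    · simp only [levelTensor, hi, Function.update_self, Pi.add_apply, Pi.smul_apply, smul_eq_mul,
        hh, if_true, bindic]
      split_ifs
      · simp
        ring
      · simp
    · simp [levelTensor, hi, hh]
  have e2 : levelTensor f a (Function.update e b l) i = a b * (l : ℝ) := by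
    simp [levelTensor, ← hb]
  simp only [Set.mem_ofPred_eq, hF, e1, e2]

lemma exists_levels_weighted_error {r : Fin n → ℕ} (f : ∀ k, Fin (d k) → Fin (r k))
    (a : Index r → ℝ) (W : Tensor d) (hW : ∀ i, 0 ≤ W i)
    {σ : ℝ} (hσ : 0 < σ) (ω : Index d → Bool)
    (ha : ∀ b, 256 * (a b ^ 2 * blockCount f ω b) ≤ σ ^ 2) (ha0 : ∀ b, 0 ≤ a b)
    {A : Tensor d → Tensor d} (hA : Measurable A) :
    ∃ e : Index r → Fin 9, ENNReal.ofReal (1/2) ≤ gaussianTensor d σ {z |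
      (∑ i, W i * a (blockMap f i) ^ 2) / 20 ≤ ∑ i, W i * (A (fun i' => bindic ω i' *
        (levelTensor f a e i' + z i')) i - levelTensor f a e i) ^ 2} := by
  set V := ∑ i, W i * a (blockMap f i) ^ 2 with hV
  have hq : ∀ i, 0 ≤ W i * a (blockMap f i) ^ 2 := fun i => mul_nonneg (hW i) (sq_nonneg _)
  have hV0 : 0 ≤ V := Finset.sum_nonneg fun i _ => hq i
  set ν := gaussianTensor d σ with hν
  set S : (Index r → Fin 9) → Index d → Set (Tensor d) := fun e i =>
    {z | |A (fun i' => bindic ω i' * (levelTensor f a e i' + z i')) i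
      - levelTensor f a e i| < a (blockMap f i) / 2} with hS
  have hSm : ∀ e i, MeasurableSet (S e i) := by
    intro e i
    have h1 : Measurable fun z : Tensor d => (fun i' => bindic ω i' *
        (levelTensor f a e i' + z i') : Tensor d) :=
      measurable_pi_lambda _ fun i' => by fun_prop
    have h2 : Measurable fun z : Tensor d =>
        A (fun i' => bindic ω i' * (levelTensor f a e i' + z i')) i :=
      (measurable_pi_apply i).comp (hA.comp h1)
    exact measurableSet_lt (by fun_prop) measurable_const
  have havg : ∑ e, ∑ i, W i * a (blockMap f i) ^ 2 * ν.real (S e i)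
      ≤ ∑ e : Index r → Fin 9, 3.45 / 9 * V := by
    rw [Finset.sum_comm]
    simp_rw [← Finset.mul_sum]
    rw [hV, Finset.mul_sum, Finset.mul_sum, Finset.sum_const, nsmul_eq_mul, Finset.mul_sum]
    refine Finset.sum_le_sum fun i _ => ?_
    have h1 := nine_mul_sum_levels (blockMap f i) fun e => ν.real (S e i)
    have h2 : ∑ e : Index r → Fin 9, ∑ l, ν.real (S (Function.update e (blockMap f i) l) i)
        ≤ ∑ e : Index r → Fin 9, 3.45 :=
      Finset.sum_le_sum fun e _ => sum_level_close_le f a hσ ω ha hA i e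
    rw [Finset.sum_const, nsmul_eq_mul] at h2
    nlinarith [hq i]
  obtain ⟨e, -, he⟩ := Finset.exists_le_of_sum_le Finset.univ_nonempty havg
  refine ⟨e, ?_⟩
  rcases hV0.eq_or_lt with h0 | hVpos
  · rw [← h0]
    have : {z : Tensor d | (0 : ℝ) / 20 ≤ ∑ i, W i * (A (fun i' => bindic ω i' *
        (levelTensor f a e i' + z i')) i - levelTensor f a e i) ^ 2} = Set.univ := by
      refine Set.eq_univ_of_forall fun z => ?_
      have : 0 ≤ ∑ i, W i * (A (fun i' => bindic ω i' *
        (levelTensor f a e i' + z i')) i - levelTensor f a e i) ^ 2 :=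
        Finset.sum_nonneg fun i _ => mul_nonneg (hW i) (sq_nonneg _)
      simpa using this
    rw [this, measure_univ]
    exact ENNReal.ofReal_le_one.2 (by norm_num)
  have hmk := (mul_measureReal_weighted_sum_ge_le ν (S e) (hSm e) _ hq (4 / 5 * V)).trans he
  set bad := {z | 4 / 5 * V ≤ ∑ i, W i * a (blockMap f i) ^ 2 *
    (S e i).indicator (fun _ => (1 : ℝ)) z} with hbad
  have hbadle : ν.real bad ≤ 1 / 2 := by
    have : V * (4 / 5 * ν.real bad) ≤ V * (3.45 / 9) := by linarith
    have := le_of_mul_le_mul_left this hVpos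
    linarith
  have hbadm : MeasurableSet bad := by
    refine measurableSet_le measurable_const (Finset.measurable_sum _ fun i _ => ?_)
    exact (measurable_const.indicator (hSm e i)).const_mul _
  have hgood : 1 / 2 ≤ ν.real badᶜ := by
    rw [probReal_compl_eq_one_sub hbadm]
    linarith
  have hgood' : ENNReal.ofReal (1 / 2) ≤ ν badᶜ := ENNReal.ofReal_le_of_le_toReal hgood
  refine hgood'.trans (measure_mono fun z hz => ?_)
  simp only [hbad, Set.mem_compl_iff, Set.mem_ofPred_eq, not_le] at hz ⊢
  have hpt : ∀ i, W i * a (blockMap f i) ^ 2 - W i * a (blockMap f i) ^ 2 *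
      (S e i).indicator (fun _ => (1 : ℝ)) z ≤ 4 * (W i * (A (fun i' => bindic ω i' *
        (levelTensor f a e i' + z i')) i - levelTensor f a e i) ^ 2) := by
    intro i
    by_cases hi : z ∈ S e i
    · rw [Set.indicator_of_mem hi]
      have := mul_nonneg (hW i) (sq_nonneg (A (fun i' => bindic ω i' *
        (levelTensor f a e i' + z i')) i - levelTensor f a e i))
      linarith
    · rw [Set.indicator_of_notMem hi]
      simp only [hS, Set.mem_ofPred_eq, not_lt] at hi
      have h1 : (a (blockMap f i) / 2) ^ 2 ≤ (A (fun i' => bindic ω i' *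
        (levelTensor f a e i' + z i')) i - levelTensor f a e i) ^ 2 := by
        rw [← sq_abs (A _ i - _)]
        exact pow_le_pow_left₀ (by have := ha0 (blockMap f i); positivity) hi 2
      have h2 := mul_le_mul_of_nonneg_left h1 (hW i)
      linarith
  have := Finset.sum_le_sum fun i (_ : i ∈ Finset.univ) => hpt i
  rw [Finset.sum_sub_distrib, ← Finset.mul_sum, ← hV] at this
  linarith

/-! ### The lower bound -/

lemma isProbabilityMeasure_bern {p : ℝ} (h0 : 0 ≤ p) (h1 : p ≤ 1) :
    IsProbabilityMeasure (bern p) := by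
  constructor
  simp only [bern, Measure.coe_add, Measure.coe_smul, Pi.add_apply, Pi.smul_apply, measure_univ,
    smul_eq_mul, mul_one]
  rw [← ENNReal.ofReal_add h0 (by linarith)]
  simp

lemma sampleMeasure_univ {W : Tensor d} (h0 : ∀ i, 0 ≤ W i) (h1 : infNorm W ≤ 1) :
    sampleMeasure W Set.univ = 1 := by
  have : ∀ i, IsProbabilityMeasure (bern (W i)) := fun i => by
    refine isProbabilityMeasure_bern (h0 i) ?_
    exact ((le_abs_self _).trans
      (le_ciSup (f := fun i => |W i|) (Set.finite_range _).bddAbove i)).trans h1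
  rw [sampleMeasure]
  exact measure_univ

lemma frobNorm_epow_half_sq {W : Tensor d} (h0 : ∀ i, 0 ≤ W i) :
    frobNorm (epow W (1/2)) ^ 2 = ∑ i, W i := by
  rw [frobNorm, Real.sq_sqrt (Finset.sum_nonneg fun i _ => sq_nonneg _)]
  refine Finset.sum_congr rfl fun i _ => ?_
  rw [epow, ← Real.sqrt_eq_rpow, Real.sq_sqrt (h0 i)]

lemma frobNorm_hadamard_epow_half_sq {W : Tensor d} (h0 : ∀ i, 0 ≤ W i) (X : Tensor d) :
    frobNorm (hadamard (epow W (1/2)) X) ^ 2 = ∑ i, W i * X i ^ 2 := by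
  rw [frobNorm, Real.sq_sqrt (Finset.sum_nonneg fun i _ => sq_nonneg _)]
  refine Finset.sum_congr rfl fun i _ => ?_
  rw [hadamard, epow, mul_pow, ← Real.sqrt_eq_rpow, Real.sq_sqrt (h0 i)]

lemma sq_mul_le_two_of_le {x P : ℝ} (hP : 1 ≤ P) (hx : 0 ≤ x) (h1 : x ≤ 1)
    (h2 : x ≤ 1 / Real.sqrt (P - 1)) : x ^ 2 * P ≤ 2 := by
  have ha : x ^ 2 ≤ 1 := pow_le_one₀ hx h1
  have hb : x ^ 2 * (P - 1) ≤ 1 := by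
    rcases hP.eq_or_lt with h | h
    · rw [← h]; norm_num
    · have hs : 0 < P - 1 := by linarith
      have := pow_le_pow_left₀ hx h2 2
      rw [div_pow, Real.sq_sqrt hs.le, one_pow, le_div_iff₀ hs] at this
      exact this
  linarith

/-- Cauchy–Schwarz lower bound for the weighted sum of squared steps. -/
lemma sq_mul_sum_le_of_sum_mul_le {ι : Type*} [Fintype ι] (W D : ι → ℝ) (hW : ∀ i, 0 ≤ W i)
    (hD : ∀ i, 0 < D i) {K : ℝ} (hK : ∑ i, W i * D i ≤ (∑ i, W i) * K) :
    ∑ i, W i ≤ (∑ i, W i / D i) * K := by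
  have hcs := Finset.sum_sq_le_sum_mul_sum_of_sq_le_mul Finset.univ
    (r := W) (f := fun i => W i / D i) (g := fun i => W i * D i)
    (fun i _ => div_nonneg (hW i) (hD i).le) (fun i _ => mul_nonneg (hW i) (hD i).le)
    (fun i _ => le_of_eq (by have := (hD i).ne'; field_simp))
  have h0 : 0 ≤ ∑ i, W i / D i := Finset.sum_nonneg fun i _ => div_nonneg (hW i) (hD i).le
  rcases (Finset.sum_nonneg fun i (_ : i ∈ Finset.univ) => hW i).eq_or_lt with h | h
  · have hz : ∀ i, W i = 0 := fun i =>
      (Finset.sum_eq_zero_iff_of_nonneg fun i _ => hW i).1 h.symm i (Finset.mem_univ i)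
    simp [hz]
  · refine le_of_mul_le_mul_left ?_ h
    calc _ = (∑ i, W i) ^ 2 := by ring
      _ ≤ _ := hcs
      _ ≤ (∑ i, W i / D i) * ((∑ i, W i) * K) := mul_le_mul_of_nonneg_left hK h0
      _ = _ := by ring

lemma exists_hard_tensor {r : Fin n → ℕ} (hr : ∀ k, 1 ≤ r k) (hd : ∀ k, 1 ≤ d k) {C' : ℝ}
    (hC' : 0 ≤ C') (w : ∀ j, Fin (d j) → ℝ)
    (hflat : ∀ (k : Fin n) (i i' : Fin (d k)), |w k i| ≤ C' * |w k i'|)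
    (hW : ∀ i, 0 ≤ outer w i) (ω : Index d → Bool) {σ β : ℝ} (hσ : 0 < σ) (hβ : 0 < β)
    {A : Tensor d → Tensor d} (hA : Measurable A) :
    ∃ T : Tensor d, TuckerRankLE T r ∧ infNorm T ≤ β ∧
      ENNReal.ofReal (1/2) ≤ gaussianTensor d σ {z : Tensor d |
        (β * σ) ^ 2 * ∑ i, outer w i ≤ 20 * (∑ i, outer w i *
          (A (fun i' => bindic ω i' * (T i' + z i')) i - T i) ^ 2) *
          (64 * σ ^ 2 + 256 * β ^ 2 * ((patCard ω : ℝ) *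
            (∏ k, (1 + C' * (r k : ℝ) / (d k : ℝ))) / ∏ k, (r k : ℝ)))} := by
  obtain ⟨f, hf⟩ := exists_blockMap_sum_le hr hd w hflat ω
  have habs : ∀ i : Index d, ∏ k, |w k (i k)| = outer w i := fun i => by
    rw [← Finset.abs_prod]; exact abs_of_nonneg (hW i)
  simp_rw [habs] at hf
  have hN : ∀ b, 0 ≤ blockCount f ω b := fun b => Finset.sum_nonneg fun i _ => by
    unfold bindic; split_ifs <;> norm_num
  set D : Index r → ℝ := fun b => 64 * σ ^ 2 + 256 * β ^ 2 * blockCount f ω b with hDdef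
  have hD : ∀ b, 0 < D b := fun b => by have := hN b; positivity
  set a : Index r → ℝ := fun b => β * σ / Real.sqrt (D b) with hadef
  have ha2 : ∀ b, a b ^ 2 = (β * σ) ^ 2 / D b := fun b => by
    rw [hadef, div_pow, Real.sq_sqrt (hD b).le]
  have ha0 : ∀ b, 0 ≤ a b := fun b => by positivity
  have haN : ∀ b, 256 * (a b ^ 2 * blockCount f ω b) ≤ σ ^ 2 := by
    intro b
    rw [ha2, div_mul_eq_mul_div, mul_div_assoc', div_le_iff₀ (hD b), hDdef]
    nlinarith [pow_pos hσ 4]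
  have haβ : ∀ b, a b * 8 ≤ β := by
    intro b
    refine le_of_sq_le_sq ?_ hβ.le
    rw [mul_pow, ha2, div_mul_eq_mul_div, div_le_iff₀ (hD b), hDdef]
    have := mul_nonneg (sq_nonneg (β ^ 2)) (hN b)
    nlinarith
  obtain ⟨e, he⟩ := exists_levels_weighted_error f a (outer w) hW hσ ω haN ha0 hA
  refine ⟨levelTensor f a e, tuckerRankLE_blockMap f fun b => a b * (e b : ℝ), ?_, ?_⟩
  · have : Nonempty (Index d) := ⟨fun k => ⟨0, hd k⟩⟩
    refine ciSup_le fun i => ?_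
    have h8 : ((e (blockMap f i) : ℕ) : ℝ) ≤ 8 := by
      exact_mod_cast Nat.lt_succ_iff.1 (e (blockMap f i)).2
    have h0 := ha0 (blockMap f i)
    rw [levelTensor, abs_of_nonneg (by positivity)]
    exact (mul_le_mul_of_nonneg_left h8 h0).trans (haβ _)
  · refine he.trans (measure_mono fun z hz => ?_)
    simp only [Set.mem_ofPred_eq] at hz ⊢
    set K := 64 * σ ^ 2 + 256 * β ^ 2 * ((patCard ω : ℝ) *
            (∏ k, (1 + C' * (r k : ℝ) / (d k : ℝ))) / ∏ k, (r k : ℝ)) with hK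
    have hWD : ∑ i, outer w i * D (blockMap f i) ≤ (∑ i, outer w i) * K := by
      have e1 : ∑ i, outer w i * D (blockMap f i) = 64 * σ ^ 2 * ∑ i, outer w i +
          256 * β ^ 2 * ∑ i, outer w i * blockCount f ω (blockMap f i) := by
        rw [Finset.mul_sum, Finset.mul_sum, ← Finset.sum_add_distrib]
        exact Finset.sum_congr rfl fun i _ => by simp only [hDdef]; ring
      rw [e1]
      have := mul_le_mul_of_nonneg_left hf (show 0 ≤ 256 * β ^ 2 by positivity)
      refine (add_le_add_right this _).trans (le_of_eq ?_)
      rw [hK]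
      ring
    have hV := sq_mul_sum_le_of_sum_mul_le (outer w) (fun i => D (blockMap f i)) hW
      (fun i => hD _) hWD
    have hVe : ∑ i, outer w i * a (blockMap f i) ^ 2
        = (β * σ) ^ 2 * ∑ i, outer w i / D (blockMap f i) := by
      rw [Finset.mul_sum]
      exact Finset.sum_congr rfl fun i _ => by rw [ha2]; ring
    rw [hVe] at hz
    have hK0 : 0 ≤ K := by positivity
    calc (β * σ) ^ 2 * ∑ i, outer w i
        ≤ (β * σ) ^ 2 * ((∑ i, outer w i / D (blockMap f i)) * K) :=
          mul_le_mul_of_nonneg_left hV (sq_nonneg _)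
      _ = ((β * σ) ^ 2 * ∑ i, outer w i / D (blockMap f i)) * K := by ring
      _ ≤ _ := mul_le_mul_of_nonneg_right (by linarith) hK0

theorem lower_bound_flat_weights :
    ∀ C' : ℝ, 1 ≤ C' →
    ∃ c C : ℝ, 0 < c ∧ 0 < C ∧ ∃ N₀ : ℕ, ∀ (n : ℕ) (d r : Fin n → ℕ),
      (∀ k, N₀ ≤ d k) → (∀ k, N₀ ≤ r k) →
      ∀ (w : ∀ j, Fin (d j) → ℝ) (W : Tensor d), W = outer w →
        (∀ i, 0 ≤ W i) → infNorm W ≤ 1 →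
        (∀ (k : Fin n) (i i' : Fin (d k)), |w k i| ≤ C' * |w k i'|) →
        ENNReal.ofReal (1 - Real.exp (-(C * frobNorm (epow W (1/2)) ^ 2))) ≤
          sampleMeasure W {ω : Index d → Bool |
            ∀ σ : ℝ, 0 < σ → ∀ β : ℝ, 0 < β →
            ∀ A : Tensor d → Tensor d, Measurable A →
            ∃ T : Tensor d, TuckerRankLE T r ∧ infNorm T ≤ β ∧
              ENNReal.ofReal (1/2) ≤ gaussianTensor d σ {z : Tensor d |
                c * min (β / Real.sqrt (Real.log (8 * ∏ k, (d k : ℝ))))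
                    (σ / Real.sqrt (patCard ω : ℝ) * Real.sqrt (∏ k, (r k : ℝ)) *
                      min (1 / Real.sqrt ((∏ k, (1 + 2 * C' ^ 2 * (r k : ℝ) / (d k : ℝ))) - 1))
                        (min 1
                          (1 / Real.sqrt ((∏ k,
                              (2 * C' * Real.sqrt ((r k : ℝ) / (d k : ℝ) * Real.log (r k)) +
                                2 * C' * ((r k : ℝ) / (d k : ℝ)) * Real.log (r k) + 1)) - 1))))
                  ≤ frobNorm (hadamard (epow W (1/2))
                      (fun i => A (fun i' => bindic ω i' * (T i' + z i')) i - T i))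
                    / frobNorm (epow W (1/2))}} := by
  intro C' hC'
  refine ⟨1 / 200, 1, by norm_num, one_pos, 1, ?_⟩
  intro n d r hd hr w W hWw hW hW1 hflat
  subst hWw
  have hm := frobNorm_epow_half_sq hW
  rcases (sq_nonneg (frobNorm (epow (outer w) (1/2)))).eq_or_lt with hm0 | hm0
  · rw [← hm0]
    simp
  refine le_trans (b := sampleMeasure (outer w) Set.univ) ?_ (measure_mono fun ω _ => ?_)
  · rw [sampleMeasure_univ hW hW1]
    exact ENNReal.ofReal_le_one.2
      (by linarith [Real.exp_pos (-(1 * frobNorm (epow (outer w) (1/2)) ^ 2))])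
  intro σ hσ β hβ A hA
  obtain ⟨T, hTr, hTβ, hT⟩ := exists_hard_tensor hr hd (by linarith) w hflat hW ω hσ hβ hA
  refine ⟨T, hTr, hTβ, hT.trans (measure_mono fun z hz => ?_)⟩
  simp only [Set.mem_ofPred_eq] at hz ⊢
  rw [← hm, ← frobNorm_hadamard_epow_half_sq hW
    (fun i => A (fun i' => bindic ω i' * (T i' + z i')) i - T i)] at hz
  set M := frobNorm (epow (outer w) (1/2)) with hM
  set X := frobNorm (hadamard (epow (outer w) (1/2))
    (fun i => A (fun i' => bindic ω i' * (T i' + z i')) i - T i)) with hX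
  have hM0 : 0 ≤ M := Real.sqrt_nonneg _
  have hMpos : 0 < M := lt_of_le_of_ne hM0 fun h => by rw [← h] at hm0; norm_num at hm0
  have hX0 : 0 ≤ X := Real.sqrt_nonneg _
  have hr0 : ∀ k, (0 : ℝ) < r k := fun k => by exact_mod_cast hr k
  have hd0 : ∀ k, (0 : ℝ) < d k := fun k => by exact_mod_cast hd k
  set P := ∏ k, (1 + 2 * C' ^ 2 * (r k : ℝ) / (d k : ℝ)) with hP
  set P' := ∏ k, (1 + C' * (r k : ℝ) / (d k : ℝ)) with hP'
  set R := ∏ k, (r k : ℝ) with hR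
  have hR0 : 0 < R := Finset.prod_pos fun k _ => hr0 k
  have hP'P : P' ≤ P := by
    refine Finset.prod_le_prod (fun k _ => by have := hr0 k; have := hd0 k; positivity) fun k _ => ?_
    have := hr0 k
    have := hd0 k
    gcongr
    nlinarith
  have hP1 : 1 ≤ P := by
    have : ∏ _k : Fin n, (1 : ℝ) ≤ P := Finset.prod_le_prod (fun _ _ => zero_le_one) fun k _ => by
      have := hr0 k
      have := hd0 k
      have : 0 ≤ 2 * C' ^ 2 * (r k : ℝ) / (d k : ℝ) := by positivity
      linarith
    simpa using this
  set Q := ∏ k, (2 * C' * Real.sqrt ((r k : ℝ) / (d k : ℝ) * Real.log (r k)) +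
    2 * C' * ((r k : ℝ) / (d k : ℝ)) * Real.log (r k) + 1) with hQ
  set x := min (1 / Real.sqrt (P - 1)) (min 1 (1 / Real.sqrt (Q - 1))) with hx
  have hx0 : 0 ≤ x := le_min (by positivity) (le_min zero_le_one (by positivity))
  have hxP : x ^ 2 * P ≤ 2 := sq_mul_le_two_of_le hP1 hx0
    ((min_le_right _ _).trans (min_le_left _ _)) (min_le_left _ _)
  set y := σ / Real.sqrt (patCard ω : ℝ) * Real.sqrt R * x with hy
  have hy0 : 0 ≤ y := by positivity
  have hyK : y ^ 2 * ((patCard ω : ℝ) * P' / R) ≤ 2 * σ ^ 2 := by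
    rcases Nat.eq_zero_or_pos (patCard ω) with h0 | h0
    · rw [h0]
      simp only [Nat.cast_zero, zero_mul, zero_div, mul_zero]
      positivity
    · have h0' : (0 : ℝ) < patCard ω := by exact_mod_cast h0
      have e : y ^ 2 * ((patCard ω : ℝ) * P' / R) = σ ^ 2 * (x ^ 2 * P') := by
        rw [hy, mul_pow, mul_pow, div_pow, Real.sq_sqrt h0'.le, Real.sq_sqrt hR0.le]
        field_simp
      rw [e]
      nlinarith [mul_le_mul_of_nonneg_left hP'P (sq_nonneg x), sq_nonneg σ]
  have hlog : 1 ≤ Real.log (8 * ∏ k, (d k : ℝ)) := by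
    have h1 : (1 : ℝ) ≤ ∏ k, (d k : ℝ) := by
      have : ∏ _k : Fin n, (1 : ℝ) ≤ ∏ k, (d k : ℝ) :=
        Finset.prod_le_prod (fun _ _ => zero_le_one) fun k _ => by exact_mod_cast hd k
      simpa using this
    rw [Real.le_log_iff_exp_le (by positivity)]
    linarith [Real.exp_one_lt_d9]
  set μ := min (β / Real.sqrt (Real.log (8 * ∏ k, (d k : ℝ)))) y with hμ
  have hμ0 : 0 ≤ μ := le_min (by positivity) hy0
  have hμβ : μ ≤ β := (min_le_left _ _).trans
    (div_le_self hβ.le (Real.one_le_sqrt.2 hlog))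
  have hμy : μ ≤ y := min_le_right _ _
  have hP'0 : 0 ≤ P' := Finset.prod_nonneg fun k _ => by
    have := hr0 k
    have := hd0 k
    positivity
  set S := (patCard ω : ℝ) * P' / R with hS
  have hS0 : 0 ≤ S := by positivity
  have hμβ2 : μ ^ 2 ≤ β ^ 2 := pow_le_pow_left₀ hμ0 hμβ 2
  have hμy2 : μ ^ 2 * S ≤ 2 * σ ^ 2 :=
    (mul_le_mul_of_nonneg_right (pow_le_pow_left₀ hμ0 hμy 2) hS0).trans hyK
  have hμK : μ ^ 2 * (64 * σ ^ 2 + 256 * β ^ 2 * S) ≤ 576 * (β * σ) ^ 2 := by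
    have h1 := mul_le_mul_of_nonneg_left hμβ2 (sq_nonneg σ)
    have h2 := mul_le_mul_of_nonneg_left hμy2 (sq_nonneg β)
    linarith
  set K := 64 * σ ^ 2 + 256 * β ^ 2 * S with hK
  have hK0 : 0 < K := by positivity
  rw [le_div_iff₀ hMpos]
  refine le_of_sq_le_sq ?_ hX0
  refine le_of_mul_le_mul_right ?_ hK0
  have h1 := mul_le_mul_of_nonneg_right hμK (sq_nonneg M)
  have h2 : 0 ≤ X ^ 2 * K := by positivity
  have h3 : (1 / 200 * μ * M) ^ 2 * K = 1 / 40000 * (μ ^ 2 * K * M ^ 2) := by ring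
  rw [h3]
  linarith

end WTC
end

section
/- Let W = w₁⊗⋯⊗wₙ ∈ ℝ^{d₁×⋯×dₙ} be a CP rank-one tensor whose every entry lies in [1/√(d₁⋯dₙ), 1], let Ω ∼ W be a random subset of [d₁]×⋯×[dₙ] (each tuple included independently with probability W_{i₁⋯iₙ}), and fix k ∈ {1,…,n}. Then with probability at least 1 − 1/(d_k + ∏_{j≠k}d_j) over the choice of Ω, max{ max_{i_k} Σ_{i₁,…,i_{k−1},i_{k+1},…,iₙ} 1_{(i₁,…,iₙ)∈Ω}/W_{i₁⋯iₙ}, max_{i₁,…,i_{k−1},i_{k+1},…,iₙ} Σ_{i_k} 1_{(i₁,…,iₙ)∈Ω}/W_{i₁⋯iₙ} } ≤ 4(d_k + ∏_{j≠k}d_j)·log(d_k + ∏_{j≠k}d_j). -/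
open MeasureTheory ProbabilityTheory Matrix
open scoped BigOperators ENNReal

namespace WTC

variable {n : ℕ}

variable {d : Fin n → ℕ}

lemma integral_bern {p : ℝ} (h0 : 0 ≤ p) (h1 : p ≤ 1) (f : Bool → ℝ) :
    ∫ b, f b ∂bern p = p * f true + (1 - p) * f false := by
  have := isProbabilityMeasure_bern h0 h1
  rw [integral_fintype Integrable.of_finite]
  simp [measureReal_def, bern, h0, h1]

lemma exp_le_one_add_mul {x : ℝ} (h0 : 0 ≤ x) (h1 : x ≤ 1) :
    Real.exp x ≤ 1 + x * (Real.exp 1 - 1) := by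
  have h := convexOn_exp.2 (Set.mem_univ (0 : ℝ)) (Set.mem_univ (1 : ℝ))
    (sub_nonneg.2 h1) h0 (by ring)
  simp only [smul_eq_mul, mul_zero, mul_one, zero_add, Real.exp_zero] at h
  linarith

lemma mgf_inverse_weight_bern_le {p B : ℝ} (h0 : 0 < p) (h1 : p ≤ 1) (hB : 0 < B)
    (hp : 1 / B ≤ p) :
    mgf (fun b : Bool => if b then 1 / p else 0) (bern p) (1 / B)
      ≤ Real.exp ((Real.exp 1 - 1) / B) := by
  rw [mgf, integral_bern h0.le h1]
  have hx : 1 / B * (1 / p) ≤ 1 := by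
    rw [mul_one_div, div_le_one h0]; exact hp
  have h := mul_le_mul_of_nonneg_left (exp_le_one_add_mul (by positivity) hx) h0.le
  have h' : p * (1 + 1 / B * (1 / p) * (Real.exp 1 - 1)) = p + (Real.exp 1 - 1) / B := by
    field_simp
  have := Real.add_one_le_exp ((Real.exp 1 - 1) / B)
  simp only [if_true, Bool.false_eq_true, if_false, mul_zero, Real.exp_zero]
  linarith

/-- Chernoff bound for a sum of inverse-probability weighted Bernoulli variables, over any
family of distinct coordinates. -/
lemma measureReal_inverse_weight_sum_ge_le {ι κ : Type*} [Fintype ι] [Fintype κ] (p : ι → ℝ)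
    {B : ℝ} (hB : 0 < B) (hp : ∀ i, 1 / B ≤ p i) (h1 : ∀ i, p i ≤ 1) {e : κ → ι}
    (he : Function.Injective e) (t : ℝ) :
    (Measure.pi fun i => bern (p i)).real
        {ω | t ≤ ∑ a, if ω (e a) then 1 / p (e a) else 0}
      ≤ Real.exp ((Fintype.card κ * (Real.exp 1 - 1) - t) / B) := by
  have h0 : ∀ i, 0 < p i := fun i => lt_of_lt_of_le (by positivity) (hp i)
  have hprob : ∀ i, IsProbabilityMeasure (bern (p i)) := fun i =>
    isProbabilityMeasure_bern (h0 i).le (h1 i)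
  let Y : ∀ i, Bool → ℝ := fun i b => if b then 1 / p i else 0
  have hmeas : ∀ i, Measurable (Y i) := fun i => measurable_of_countable _
  have hind : iIndepFun (fun (a : κ) (ω : ι → Bool) => Y (e a) (ω (e a)))
      (Measure.pi fun i => bern (p i)) :=
    (iIndepFun_pi (X := Y) fun i => (hmeas i).aemeasurable).precomp he
  have hmgf := hind.mgf_sum (t := 1 / B)
    (fun a => (hmeas (e a)).comp (measurable_pi_apply (e a))) Finset.univ
  have hone : ∀ a, mgf (fun ω : ι → Bool => Y (e a) (ω (e a)))
      (Measure.pi fun i => bern (p i)) (1 / B) ≤ Real.exp ((Real.exp 1 - 1) / B) := by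
    intro a
    refine le_trans (le_of_eq ?_)
      (mgf_inverse_weight_bern_le (h0 (e a)) (h1 (e a)) hB (hp (e a)))
    have hmap : Measure.map (fun ω : ι → Bool => ω (e a)) (Measure.pi fun i => bern (p i))
        = bern (p (e a)) := (measurePreserving_eval (fun i => bern (p i)) (e a)).map_eq
    have hev : Measurable fun ω : ι → Bool => ω (e a) := measurable_pi_apply (e a)
    rw [← hmap, mgf_map hev.aemeasurable
      (measurable_of_countable _).aestronglyMeasurable]
    rfl
  have hch := measure_ge_le_exp_mul_mgf (μ := Measure.pi fun i => bern (p i))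
    (X := ∑ a, fun ω : ι → Bool => Y (e a) (ω (e a))) (t := 1 / B) t (by positivity)
    Integrable.of_finite
  rw [hmgf] at hch
  simp only [Finset.sum_apply] at hch
  refine hch.trans ?_
  calc _ ≤ Real.exp (-(1 / B) * t) * ∏ _a : κ, Real.exp ((Real.exp 1 - 1) / B) := by
        gcongr with a
        · exact fun _ _ => mgf_nonneg
        · exact hone a
    _ = _ := by
        rw [Finset.prod_const, ← Real.exp_nat_mul, ← Real.exp_add, Finset.card_univ]
        congr 1
        field_simp
        ring

lemma embed_injective_right {n : ℕ} {d : Fin n → ℕ} (k : Fin n) (ik : Fin (d k)) :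
    Function.Injective (embed (d := d) k ik) := by
  intro r s h
  funext j
  have := congrFun h j.1
  simpa [embed, j.2] using this

lemma embed_injective_left {n : ℕ} {d : Fin n → ℕ} (k : Fin n) (rest : RestIdx d k) :
    Function.Injective (fun ik => embed (d := d) k ik rest) := by
  intro r s h
  have := congrFun h k
  simpa [embed] using this

lemma Dk_eq_add_card {n : ℕ} (d : Fin n → ℕ) (k : Fin n) :
    Dk d k = (d k + Fintype.card (RestIdx d k) : ℕ) := by
  simp only [Dk, Fintype.card_pi, Fintype.card_fin]
  push_cast
  congr 1
  rw [Finset.prod_subtype (p := fun j => j ≠ k) _ (by simp) fun j => (d j : ℝ)]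

lemma sqrt_prod_le_half_Dk {n : ℕ} (d : Fin n → ℕ) (k : Fin n) :
    Real.sqrt (∏ j, (d j : ℝ)) ≤ Dk d k / 2 := by
  rw [← Finset.mul_prod_erase _ _ (Finset.mem_univ k), Dk]
  apply Real.sqrt_le_iff.2
  constructor
  · positivity
  · nlinarith [sq_nonneg ((d k : ℝ) - ∏ j ∈ Finset.univ.erase k, (d j : ℝ))]

lemma chernoff_exponent_le {N B D : ℝ} (hD : 2 ≤ D) (hN : N ≤ D) (hB : 0 < B)
    (hBD : B ≤ D / 2) :
    Real.exp ((N * (Real.exp 1 - 1) - 4 * D * Real.log D) / B) ≤ 1 / D ^ 2 := by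
  have hD0 : 0 < D := by linarith
  have hlog : 0.69 ≤ Real.log D := by
    have := Real.log_le_log (by norm_num) hD
    have := Real.log_two_gt_d9
    linarith
  have hexp := Real.exp_one_lt_d9
  have hexp1 : 0 ≤ Real.exp 1 - 1 := by linarith [Real.add_one_le_exp (1 : ℝ)]
  have hrhs : 1 / D ^ 2 = Real.exp (-(2 * Real.log D)) := by
    rw [Real.exp_neg, mul_comm, Real.exp_mul, Real.exp_log hD0]
    norm_num
  rw [hrhs, Real.exp_le_exp, div_le_iff₀ hB]
  have h1 : N * (Real.exp 1 - 1) ≤ D * 1.72 :=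
    mul_le_mul hN (by linarith) hexp1 hD0.le
  have h2 : B * Real.log D ≤ D / 2 * Real.log D :=
    mul_le_mul_of_nonneg_right hBD (by linarith)
  have h3 : D * 0.69 ≤ D * Real.log D := mul_le_mul_of_nonneg_left hlog hD0.le
  linarith

theorem mu_bound_random_pattern
    {n : ℕ} {d : Fin n → ℕ} (w : ∀ j, Fin (d j) → ℝ) (W : Tensor d)
    (hW : W = outer w)
    (hent : ∀ i, 1 / Real.sqrt (∏ j, (d j : ℝ)) ≤ W i ∧ W i ≤ 1)
    (k : Fin n) :
    ENNReal.ofReal (1 - 1 / Dk d k) ≤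
      sampleMeasure W {ω : Index d → Bool |
        max (⨆ ik : Fin (d k), ∑ rest : RestIdx d k,
              (if ω (embed k ik rest) then 1 / W (embed k ik rest) else 0))
            (⨆ rest : RestIdx d k, ∑ ik : Fin (d k),
              (if ω (embed k ik rest) then 1 / W (embed k ik rest) else 0))
          ≤ 4 * Dk d k * Real.log (Dk d k)} := by
  classical
  have hDc := Dk_eq_add_card d k
  have hT : 0 ≤ 4 * Dk d k * Real.log (Dk d k) := by
    rw [hDc]
    exact mul_nonneg (by positivity) (Real.log_natCast_nonneg _)
  have hpos : ∀ i, 0 < W i := by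
    intro i
    have : ∀ j, 0 < d j := fun j => Fin.pos (i j)
    refine lt_of_lt_of_le ?_ (hent i).1
    have : 0 < ∏ j, (d j : ℝ) := Finset.prod_pos fun j _ => by exact_mod_cast this j
    positivity
  have hprob : ∀ i, IsProbabilityMeasure (bern (W i)) := fun i =>
    isProbabilityMeasure_bern (hpos i).le (hent i).2
  have : IsProbabilityMeasure (sampleMeasure W) := by
    unfold sampleMeasure; infer_instance
  set T := 4 * Dk d k * Real.log (Dk d k)
  let R : Fin (d k) → Set (Index d → Bool) := fun ik =>
    {ω | T ≤ ∑ rest, if ω (embed k ik rest) then 1 / W (embed k ik rest) else 0}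
  let C : RestIdx d k → Set (Index d → Bool) := fun rest =>
    {ω | T ≤ ∑ ik, if ω (embed k ik rest) then 1 / W (embed k ik rest) else 0}
  set S : Set (Index d → Bool) := {ω | max _ _ ≤ T}
  have hsub : Sᶜ ⊆ (⋃ ik, R ik) ∪ ⋃ rest, C rest := by
    intro ω hω
    by_contra hcon
    simp only [Set.mem_union, Set.mem_iUnion, not_or, not_exists] at hcon
    refine hω (max_le (Real.iSup_le (fun ik => ?_) hT) (Real.iSup_le (fun rest => ?_) hT))
    · exact (not_le.1 (hcon.1 ik)).le
    · exact (not_le.1 (hcon.2 rest)).le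
  by_cases hne : Nonempty (Index d)
  · obtain ⟨i₀⟩ := hne
    have hd : ∀ j, 0 < d j := fun j => Fin.pos (i₀ j)
    have hB : 0 < Real.sqrt (∏ j, (d j : ℝ)) :=
      Real.sqrt_pos.2 (Finset.prod_pos fun j _ => by exact_mod_cast hd j)
    have hcard : 0 < Fintype.card (RestIdx d k) :=
      Fintype.card_pos_iff.2 ⟨fun j => i₀ j.1⟩
    have hD : 2 ≤ Dk d k := by
      rw [hDc]; exact_mod_cast Nat.add_le_add (hd k) hcard
    have hR : ∀ ik, (sampleMeasure W).real (R ik) ≤ 1 / Dk d k ^ 2 := fun ik =>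
      (measureReal_inverse_weight_sum_ge_le W hB (fun i => (hent i).1) (fun i => (hent i).2)
        (embed_injective_right k ik) T).trans
        (chernoff_exponent_le hD (by rw [hDc]; exact_mod_cast Nat.le_add_left _ _) hB
          (sqrt_prod_le_half_Dk d k))
    have hC : ∀ rest, (sampleMeasure W).real (C rest) ≤ 1 / Dk d k ^ 2 := fun rest =>
      (measureReal_inverse_weight_sum_ge_le W hB (fun i => (hent i).1) (fun i => (hent i).2)
        (embed_injective_left k rest) T).trans
        (chernoff_exponent_le hD
          (by rw [hDc, Fintype.card_fin]; exact_mod_cast Nat.le_add_right _ _) hB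
          (sqrt_prod_le_half_Dk d k))
    have hcompl : (sampleMeasure W).real Sᶜ ≤ 1 / Dk d k := by
      calc (sampleMeasure W).real Sᶜ
          ≤ (sampleMeasure W).real ((⋃ ik, R ik) ∪ ⋃ rest, C rest) := measureReal_mono hsub
        _ ≤ (sampleMeasure W).real (⋃ ik, R ik) + (sampleMeasure W).real (⋃ rest, C rest) :=
            measureReal_union_le _ _
        _ ≤ ∑ ik, (sampleMeasure W).real (R ik) + ∑ rest, (sampleMeasure W).real (C rest) :=
            add_le_add (measureReal_iUnion_fintype_le _) (measureReal_iUnion_fintype_le _)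
        _ ≤ ∑ _ik : Fin (d k), 1 / Dk d k ^ 2 + ∑ _rest : RestIdx d k, 1 / Dk d k ^ 2 :=
            add_le_add (Finset.sum_le_sum fun ik _ => hR ik)
              (Finset.sum_le_sum fun rest _ => hC rest)
        _ = ((d k + Fintype.card (RestIdx d k) : ℕ) : ℝ) * (1 / Dk d k ^ 2) := by
            simp only [Finset.sum_const, Finset.card_univ, Fintype.card_fin, nsmul_eq_mul]
            push_cast
            ring
        _ = 1 / Dk d k := by
            rw [← hDc]
            have : Dk d k ≠ 0 := by linarith
            field_simp
    have hmeas : MeasurableSet S := (Set.toFinite S).measurableSet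
    rw [probReal_compl_eq_one_sub hmeas] at hcompl
    refine ENNReal.ofReal_le_of_le_toReal ?_
    change _ ≤ (sampleMeasure W).real S
    linarith
  · have huniv : S = Set.univ := by
      refine Set.eq_univ_of_forall fun ω => ?_
      refine max_le (Real.iSup_le (fun ik => ?_) hT) (Real.iSup_le (fun rest => ?_) hT)
      · exact (Finset.sum_eq_zero fun rest _ => (hne ⟨embed k ik rest⟩).elim).trans_le hT
      · exact (Finset.sum_eq_zero fun ik _ => (hne ⟨embed k ik rest⟩).elim).trans_le hT
    rw [huniv, measure_univ, ENNReal.ofReal_le_one, hDc]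
    have : (0 : ℝ) ≤ 1 / ((d k + Fintype.card (RestIdx d k) : ℕ) : ℝ) := by positivity
    linarith

end WTC
end
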